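/- arXiv:math/0312320 — 6 statements merged into one kernel-verified Lean document; each statement's English description precedes it below -/
import Mathlib

section
/- Let q ∈ ℕ, q ≥ 2. Then δ(K⁰_{1,q}) = δ(K_{1,q}) = A(1/q), where K⁰_{1,q} = {1, 2, …, q−1} and K_{1,q} = {qν + k : ν ∈ ℤ_{≥0}, k ∈ K⁰_{1,q}}. -/
open Real

/-- Evaluation of the trigonometric polynomial with (finitely supported) cosine
coefficients `c` at the point `x`:  `T(x) = Σ_k c k · cos(2πkx)`.
The constant term is the `k = 0` coefficient. -/
noncomputable def trigEval (c : ℕ →₀ ℝ) (x : ℝ) : ℝ :=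
  c.sum fun k a => a * Real.cos (2 * π * k * x)

/-- The class `𝐓(K)`: trigonometric polynomials `T(x) = T₀ + Σ_{k ∈ K} T_k cos(2πkx)`
(nonzero-frequency coefficients supported in `K`), with `T(x) ≥ 0` for all `x`
and `T(0) = 1`.  A polynomial is represented by its coefficient function. -/
def TrigClass (K : Set ℕ) : Set (ℕ →₀ ℝ) :=
  {c | (∀ k : ℕ, k ≠ 0 → c k ≠ 0 → k ∈ K) ∧
       (∀ x : ℝ, 0 ≤ trigEval c x) ∧
       trigEval c 0 = 1}

/-- `δ(K) = inf_{T ∈ 𝐓(K)} T₀`. -/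
noncomputable def delta (K : Set ℕ) : ℝ :=
  sInf ((fun c : ℕ →₀ ℝ => c 0) '' TrigClass K)

/-- The Turán class `K(h)`, described by the cosine coefficient sequence `a`:
`a_n ≥ 0`, `Σ a_n = 1` (i.e. `f(0) = 1`), and
`f(x) = Σ_n a_n cos(2πnx) = 0` for `h ≤ |x| ≤ 1/2`. -/
def TuranClass (h : ℝ) : Set (ℕ → ℝ) :=
  {a | (∀ n, 0 ≤ a n) ∧ Summable a ∧ (∑' n, a n) = 1 ∧
       ∀ x : ℝ, h ≤ |x| → |x| ≤ 1 / 2 →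
         (∑' n : ℕ, a n * Real.cos (2 * π * n * x)) = 0}

/-- `A(h) = sup_{f ∈ K(h)} a₀`. -/
noncomputable def turanA (h : ℝ) : ℝ :=
  sSup ((fun a : ℕ → ℝ => a 0) '' TuranClass h)

/-- `K⁰_{p,q} = {p, p+1, …, q−p}`. -/
def Kset0 (p q : ℕ) : Set ℕ := {k | p ≤ k ∧ k ≤ q - p}

/-- `K_{p,q} = {qν + k : ν ∈ ℤ₊, k ∈ K⁰_{p,q}}`. -/
def Kset (p q : ℕ) : Set ℕ :=
  {k | ∃ ν k' : ℕ, k = q * ν + k' ∧ p ≤ k' ∧ k' ≤ q - p}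


lemma aux_fejer (θ : ℝ) (m : ℕ) :
    (m + 1 : ℝ) + 2 * ∑ k ∈ Finset.range m, ((m : ℝ) - k) * Real.cos ((k + 1 : ℕ) * θ)
      = (∑ j ∈ Finset.range (m + 1), Real.cos (j * θ)) ^ 2
        + (∑ j ∈ Finset.range (m + 1), Real.sin (j * θ)) ^ 2 := by
  induction m with
  | zero => simp
  | succ m ih =>
    rw [Finset.sum_range_succ _ (m + 1), Finset.sum_range_succ (fun j : ℕ => Real.sin (j * θ)) (m + 1)]
    have h1 : Real.cos ((m + 1 : ℕ) * θ) * (∑ j ∈ Finset.range (m + 1), Real.cos (j * θ))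
        + Real.sin ((m + 1 : ℕ) * θ) * (∑ j ∈ Finset.range (m + 1), Real.sin (j * θ))
        = ∑ k ∈ Finset.range (m + 1), Real.cos ((k + 1 : ℕ) * θ) := by
      rw [Finset.mul_sum, Finset.mul_sum, ← Finset.sum_add_distrib,
        ← Finset.sum_range_reflect (fun k : ℕ => Real.cos ((k + 1 : ℕ) * θ))]
      refine Finset.sum_congr rfl fun j hj => ?_
      rw [← Real.cos_sub]
      have hj' : j ≤ m := by simpa [Nat.lt_succ_iff] using hj
      congr 1
      have : m + 1 - 1 - j + 1 = m + 1 - j := by omega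
      rw [this, Nat.cast_sub (by omega)]
      ring
    have h2 : ∑ k ∈ Finset.range (m + 1), (((m + 1 : ℕ) : ℝ) - k) * Real.cos ((k + 1 : ℕ) * θ)
        = ∑ k ∈ Finset.range m, ((m : ℝ) - k) * Real.cos ((k + 1 : ℕ) * θ)
          + ∑ k ∈ Finset.range (m + 1), Real.cos ((k + 1 : ℕ) * θ) := by
      have : ∑ k ∈ Finset.range m, ((m : ℝ) - k) * Real.cos ((k + 1 : ℕ) * θ)
          = ∑ k ∈ Finset.range (m + 1), ((m : ℝ) - k) * Real.cos ((k + 1 : ℕ) * θ) := by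
        rw [Finset.sum_range_succ]; simp
      rw [this, ← Finset.sum_add_distrib]
      refine Finset.sum_congr rfl fun j hj => ?_
      push_cast
      ring
    have h3 := Real.sin_sq_add_cos_sq ((m + 1 : ℕ) * θ)
    rw [h2]
    have h4 : ((m + 1 : ℕ) : ℝ) = m + 1 := by push_cast; ring
    have h5 : (((m + 1 : ℕ) : ℝ) + 1) = m + 1 + 1 := by rw [h4]
    rw [h5]
    linarith [ih, h1, h3]

lemma aux_S (q : ℕ) (hq : 2 ≤ q) (n : ℕ) :
    ∑ j ∈ Finset.range q, Real.cos (2 * π * n * (j / q : ℝ)) = if q ∣ n then (q : ℝ) else 0 := by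
  have hq0 : q ≠ 0 := by omega
  have hqR : (q : ℝ) ≠ 0 := by exact_mod_cast hq0
  split_ifs with h
  · obtain ⟨m, rfl⟩ := h
    have : ∀ j ∈ Finset.range q, Real.cos (2 * π * (q * m : ℕ) * (j / q : ℝ)) = 1 := by
      intro j _
      have : 2 * π * (q * m : ℕ) * (j / q : ℝ) = ((m * j : ℕ) : ℝ) * (2 * π) := by
        push_cast; field_simp
      rw [this, Real.cos_nat_mul_two_pi]
    rw [Finset.sum_congr rfl this]; simp
  · have hp := Complex.isPrimitiveRoot_exp q hq0
    set ζ := Complex.exp (2 * π * Complex.I / q) with hζ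
    have hne : ζ ^ n ≠ 1 := fun e => h (hp.dvd_of_pow_eq_one n e)
    have hone : (ζ ^ n) ^ q = 1 := by rw [← pow_mul, mul_comm, pow_mul, hp.pow_eq_one, one_pow]
    have hs : ∑ j ∈ Finset.range q, (ζ ^ n) ^ j = 0 := by
      rw [geom_sum_eq hne, hone]; simp
    have hre := congrArg Complex.re hs
    rw [Complex.re_sum] at hre
    rw [← Complex.zero_re, ← hre]
    refine Finset.sum_congr rfl fun j _ => ?_
    rw [hζ, ← pow_mul, ← Complex.exp_nat_mul]
    have : ((n * j : ℕ) : ℂ) * (2 * π * Complex.I / q)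
        = ((2 * π * n * (j / q : ℝ) : ℝ) : ℂ) * Complex.I := by
      push_cast; ring
    rw [this, Complex.exp_ofReal_mul_I_re]

lemma aux_delta_lower (q : ℕ) (hq : 2 ≤ q) (c : ℕ →₀ ℝ) (hc : c ∈ TrigClass (Kset 1 q)) :
    1 / (q : ℝ) ≤ c 0 := by
  obtain ⟨h1, h2, h3⟩ := hc
  have hqR : (0 : ℝ) < q := by exact_mod_cast (by omega : 0 < q)
  have e : ∑ j ∈ Finset.range q, trigEval c (j / q : ℝ) = q * c 0 := by
    unfold trigEval Finsupp.sum
    rw [Finset.sum_comm]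
    simp_rw [← Finset.mul_sum, aux_S q hq]
    rw [Finset.sum_eq_single 0]
    · simp [mul_comm]
    · intro k hk hk0
      rw [if_neg, mul_zero]
      intro hd
      obtain ⟨ν, k', e, a, b⟩ := h1 k hk0 (by simpa using hk)
      have : q ∣ k' := by
        rw [e] at hd
        exact (Nat.dvd_add_right (Dvd.intro _ rfl)).1 hd
      have := Nat.le_of_dvd (by omega) this
      omega
    · intro h
      simp at h
      simp [h]
  have : trigEval c 0 ≤ ∑ j ∈ Finset.range q, trigEval c (j / q : ℝ) := by
    have := Finset.single_le_sum (f := fun j : ℕ => trigEval c (j / q : ℝ))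
      (fun j _ => h2 _) (Finset.mem_range.2 (by omega : 0 < q))
    simpa using this
  rw [div_le_iff₀ hqR]
  linarith

lemma aux_sub (q : ℕ) : TrigClass (Kset0 1 q) ⊆ TrigClass (Kset 1 q) := by
  rintro c ⟨h1, h2⟩
  exact ⟨fun k a b => ⟨0, k, by simp, h1 k a b⟩, h2⟩

lemma aux_exists (q : ℕ) (hq : 2 ≤ q) : ∃ c ∈ TrigClass (Kset0 1 q), c 0 = 1 / (q : ℝ) := by
  obtain ⟨m, rfl⟩ : ∃ m, q = m + 1 := ⟨q - 1, by omega⟩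
  let f : ℕ → ℝ := fun k => if k = 0 then 1 / ((m + 1 : ℕ) : ℝ) else
    if k < m + 1 then 2 * ((m + 1 : ℝ) - k) / (m + 1 : ℝ) ^ 2 else 0
  have hf : ∀ k, f k ≠ 0 → k ∈ Finset.range (m + 1) := by
    intro k hk
    by_contra h
    simp at h
    apply hk
    simp only [f]
    rw [if_neg (by omega), if_neg (by omega)]
  have hm : (0 : ℝ) < m + 1 := by positivity
  have hev : ∀ x, trigEval (Finsupp.onFinset (Finset.range (m + 1)) f hf) x
      = ((∑ j ∈ Finset.range (m + 1), Real.cos (j * (2 * π * x))) ^ 2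
        + (∑ j ∈ Finset.range (m + 1), Real.sin (j * (2 * π * x))) ^ 2) / (m + 1) ^ 2 := by
    intro x
    unfold trigEval
    rw [Finsupp.onFinset_sum _ (by simp), ← aux_fejer, Finset.sum_range_succ', add_div,
      mul_div_assoc, Finset.sum_div, Finset.mul_sum, add_comm]
    congr 1
    · simp [f]
      field_simp
    · refine Finset.sum_congr rfl fun k hk => ?_
      have hk' : k < m := by simpa using hk
      simp only [f]
      rw [if_neg (by omega), if_pos (by omega)]
      have : 2 * π * ((k + 1 : ℕ) : ℝ) * x = ((k + 1 : ℕ) : ℝ) * (2 * π * x) := by ring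
      rw [this]
      push_cast
      ring
  refine ⟨Finsupp.onFinset (Finset.range (m + 1)) f hf, ⟨?_, ?_, ?_⟩, ?_⟩
  · intro k hk hk'
    have := hf k hk'
    simp at this
    refine ⟨by omega, by omega⟩
  · intro x
    rw [hev]; positivity
  · rw [hev]
    simp
    exact hm.ne.symm
  · simp [f]

lemma aux_turan_upper (q : ℕ) (hq : 2 ≤ q) (a : ℕ → ℝ) (ha : a ∈ TuranClass (1 / q)) :
    a 0 ≤ 1 / (q : ℝ) := by
  obtain ⟨h0, hs, h1, hz⟩ := ha
  have hqR : (0 : ℝ) < q := by exact_mod_cast (by omega : 0 < q)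
  have hsum : ∀ x : ℝ, Summable fun n : ℕ => a n * Real.cos (2 * π * n * x) := by
    intro x
    refine Summable.of_norm_bounded hs fun n => ?_
    rw [Real.norm_eq_abs, abs_mul, abs_of_nonneg (h0 n)]
    exact mul_le_of_le_one_right (h0 n) (Real.abs_cos_le_one _)
  have hzero : ∀ j ∈ Finset.range q, j ≠ 0 →
      ∑' n : ℕ, a n * Real.cos (2 * π * n * (j / q : ℝ)) = 0 := by
    intro j hj hj0
    have hjq : j + 1 ≤ q := by simpa using hj
    have hjq' : (j : ℝ) + 1 ≤ q := by exact_mod_cast hjq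
    have hj1 : (1 : ℝ) ≤ j := by exact_mod_cast (by omega : 1 ≤ j)
    by_cases hh : (j / q : ℝ) ≤ 1 / 2
    · refine hz _ ?_ ?_
      · rw [abs_of_nonneg (by positivity)]
        gcongr
      · rwa [abs_of_nonneg (by positivity)]
    · have := hz (j / q - 1) ?_ ?_
      · rw [← this]
        refine tsum_congr fun n => ?_
        have : 2 * π * (n : ℝ) * (j / q - 1) = 2 * π * n * (j / q) - n * (2 * π) := by ring
        rw [this, Real.cos_sub_nat_mul_two_pi]
      · rw [abs_sub_comm]
        refine le_trans ?_ (le_abs_self _)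
        rw [le_sub_iff_add_le, ← add_div, div_le_one hqR]
        linarith
      · have : (j / q : ℝ) ≤ 1 := by rw [div_le_one hqR]; linarith
        rw [abs_le]
        push Not at hh
        constructor <;> linarith
  have e : ∑ j ∈ Finset.range q, ∑' n : ℕ, a n * Real.cos (2 * π * n * (j / q : ℝ)) = 1 := by
    rw [Finset.sum_eq_single 0 hzero]
    · simpa using h1
    · intro h; simp at h; omega
  rw [← Summable.tsum_finsetSum (fun j _ => hsum _)] at e
  have hsm : Summable fun n : ℕ => ∑ j ∈ Finset.range q, a n * Real.cos (2 * π * n * (j / q : ℝ)) :=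
    summable_sum fun j _ => hsum _
  have := hsm.le_tsum 0 (fun n _ => by
    rw [← Finset.mul_sum, aux_S q hq]
    have := h0 n
    split_ifs <;> positivity)
  rw [e] at this
  rw [le_div_iff₀ hqR]
  simp at this
  linarith

lemma aux_B2 (x : ℝ) (hx : x ∈ Set.Icc (0 : ℝ) 1) :
    HasSum (fun n : ℕ => 1 / (n : ℝ) ^ 2 * Real.cos (2 * π * n * x)) (π ^ 2 * (x ^ 2 - x + 1 / 6)) := by
  have h := hasSum_one_div_nat_pow_mul_cos (k := 1) one_ne_zero hx
  convert h using 1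
  have e : (Polynomial.map (algebraMap ℚ ℝ) (Polynomial.bernoulli (2 * 1))).eval x
      = x ^ 2 - x + 1 / 6 := by
    simp [Polynomial.bernoulli, Finset.sum_range_succ, bernoulli_two, bernoulli_one]
    ring
  rw [e]
  have hf : ((2 * 1).factorial : ℝ) = 2 := by norm_num [Nat.factorial]
  rw [hf]
  ring

lemma aux_turan_exists (h : ℝ) (h0 : 0 < h) (h2 : h ≤ 1 / 2) : ∃ a ∈ TuranClass h, a 0 = h := by
  let a : ℕ → ℝ := fun n => (if n = 0 then h else 0)
    + 1 / (h * π ^ 2) * (1 / (n : ℝ) ^ 2 * (1 - Real.cos (2 * π * n * h)))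
  have hpi := Real.pi_pos
  have hδ : ∀ x : ℝ, HasSum (fun n : ℕ => (if n = 0 then h else 0) * Real.cos (2 * π * n * x)) h := by
    intro x
    have := hasSum_ite_eq (0 : ℕ) h
    convert this using 2 with n
    split_ifs with hn <;> simp [hn]
  have key : ∀ x : ℝ, h ≤ x → x ≤ 1 / 2 →
      HasSum (fun n : ℕ => a n * Real.cos (2 * π * n * x)) 0 := by
    intro x hx hx2
    have k1 := aux_B2 x ⟨by linarith, by linarith⟩
    have k2 := aux_B2 (x + h) ⟨by linarith, by linarith⟩
    have k3 := aux_B2 (x - h) ⟨by linarith, by linarith⟩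
    have := (hδ x).add ((k1.sub ((k2.add k3).div_const 2)).mul_left (1 / (h * π ^ 2)))
    convert this using 1
    · funext n
      have e1 : 2 * π * n * (x + h) = 2 * π * n * x + 2 * π * n * h := by ring
      have e2 : 2 * π * n * (x - h) = 2 * π * n * x - 2 * π * n * h := by ring
      rw [e1, e2, Real.cos_add, Real.cos_sub]
      simp only [a]
      ring
    · field_simp
      ring
  have key0 : HasSum a 1 := by
    have k1 := aux_B2 0 ⟨by linarith, by linarith⟩
    have k2 := aux_B2 h ⟨by linarith, by linarith⟩
    have := (hδ 0).add ((k1.sub k2).mul_left (1 / (h * π ^ 2)))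
    convert this using 1
    · funext n
      simp only [a, mul_zero, Real.cos_zero]
      ring
    · field_simp
      ring
  refine ⟨a, ⟨?_, key0.summable, key0.tsum_eq, ?_⟩, by simp [a]⟩
  · intro n
    have := sub_nonneg.2 (Real.cos_le_one (2 * π * n * h))
    simp only [a]
    split_ifs <;> positivity
  · intro x hx hx2
    rw [← (key |x| hx hx2).tsum_eq]
    refine tsum_congr fun n => ?_
    rcases abs_cases x with ⟨e, _⟩ | ⟨e, _⟩
    · rw [e]
    · rw [e, mul_neg, Real.cos_neg]

/-- Theorem 1, case `p = 1`:  `δ(K⁰_{1,q}) = δ(K_{1,q}) = A(1/q)` for `q ≥ 2`. -/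
theorem stmt_0 (q : ℕ) (hq : 2 ≤ q) :
    delta (Kset0 1 q) = turanA (1 / q) ∧ delta (Kset 1 q) = turanA (1 / q) := by
  have hqR : (2 : ℝ) ≤ q := by exact_mod_cast hq
  have hA : turanA (1 / q) = 1 / q := by
    refine IsGreatest.csSup_eq ⟨?_, ?_⟩
    · exact aux_turan_exists (1 / q) (by positivity) (by gcongr)
    · rintro _ ⟨a, ha, rfl⟩
      exact aux_turan_upper q hq a ha
  obtain ⟨c, hc, hc0⟩ := aux_exists q hq
  rw [hA]
  constructor
  · refine IsLeast.csInf_eq ⟨⟨c, hc, hc0⟩, ?_⟩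
    rintro _ ⟨a, ha, rfl⟩
    exact aux_delta_lower q hq a (aux_sub q ha)
  · refine IsLeast.csInf_eq ⟨⟨c, aux_sub q hc, hc0⟩, ?_⟩
    rintro _ ⟨a, ha, rfl⟩
    exact aux_delta_lower q hq a ha
end

section
/- Let q be an odd integer with q ≥ 5. Then δ(K⁰_{2,q}) = δ(K_{2,q}) = A(2/q), where K⁰_{2,q} = {2, 3, …, q−2} and K_{2,q} = {qν + k : ν ∈ ℤ_{≥0}, k ∈ K⁰_{2,q}}. -/
open Real

noncomputable def wt (k : ℕ) : ℝ := if k = 0 then 1 else 2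

theorem fejer_id (θ : ℝ) (N : ℕ) :
    ∑ k ∈ Finset.range N, wt k * ((N : ℝ) - k) * Real.cos (k * θ)
      = (∑ j ∈ Finset.range N, Real.cos (j * θ)) ^ 2
        + (∑ j ∈ Finset.range N, Real.sin (j * θ)) ^ 2 := by
  induction N with
  | zero => simp
  | succ N ih =>
    have h1 : ∑ k ∈ Finset.range (N + 1), wt k * (((N + 1 : ℕ) : ℝ) - k) * Real.cos (k * θ)
        = ∑ k ∈ Finset.range N, wt k * ((N : ℝ) - k) * Real.cos (k * θ)
          + ∑ k ∈ Finset.range (N + 1), wt k * Real.cos (k * θ) := by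
      rw [Finset.sum_range_succ, Finset.sum_range_succ (fun k : ℕ => wt k * Real.cos (k * θ)),
        ← add_assoc, ← Finset.sum_add_distrib]
      congr 1
      · apply Finset.sum_congr rfl
        intro k _
        push_cast
        ring
      · push_cast
        ring
    have h2 : ∑ k ∈ Finset.range (N + 1), wt k * Real.cos (k * θ)
        = 1 + 2 * ∑ j ∈ Finset.range N, Real.cos ((N : ℝ) * θ - j * θ) := by
      rw [Finset.sum_range_succ', ← Finset.sum_range_reflect, Finset.mul_sum, add_comm]
      congr 1
      · simp [wt]
      · apply Finset.sum_congr rfl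
        intro j hj
        have hj' : j + 1 ≤ N := Finset.mem_range.mp hj
        have e : N - 1 - j + 1 = N - j := by omega
        have e2 : N - j ≠ 0 := by omega
        rw [e, Nat.cast_sub (by omega), sub_mul]
        simp [wt, e2]
    rw [h1, h2, ih]
    have h3 : ∑ j ∈ Finset.range N, Real.cos ((N : ℝ) * θ - j * θ)
        = Real.cos (N * θ) * (∑ j ∈ Finset.range N, Real.cos (j * θ))
          + Real.sin (N * θ) * (∑ j ∈ Finset.range N, Real.sin (j * θ)) := by
      rw [Finset.mul_sum, Finset.mul_sum, ← Finset.sum_add_distrib]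
      apply Finset.sum_congr rfl
      intro j _
      rw [Real.cos_sub]
    rw [h3, Finset.sum_range_succ, Finset.sum_range_succ]
    have := Real.sin_sq_add_cos_sq (N * θ)
    linear_combination (-1) * this

theorem fejer_zero (θ : ℝ) (q : ℕ) (h1 : Real.cos θ ≠ 1)
    (h2 : ∃ m : ℕ, q * θ = m * (2 * π)) :
    ∑ k ∈ Finset.range q, wt k * ((q : ℝ) - k) * Real.cos (k * θ) = 0 := by
  obtain ⟨m, hm⟩ := h2
  rw [fejer_id]
  have hz : Complex.exp (θ * Complex.I) ≠ 1 := by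
    intro h
    apply h1
    have := congrArg Complex.re h
    rwa [Complex.exp_ofReal_mul_I_re, Complex.one_re] at this
  have hq : Complex.exp (θ * Complex.I) ^ q = 1 := by
    rw [← Complex.exp_nat_mul, Complex.exp_eq_one_iff]
    refine ⟨m, ?_⟩
    have : (q : ℂ) * θ = m * (2 * π) := by exact_mod_cast hm
    push_cast
    linear_combination Complex.I * this
  have hs : ∑ j ∈ Finset.range q, Complex.exp (θ * Complex.I) ^ j = 0 := by
    rw [geom_sum_eq hz, hq]
    simp
  have hs2 : ∑ j ∈ Finset.range q, Complex.exp (((j * θ : ℝ) : ℂ) * Complex.I) = 0 := by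
    rw [← hs]
    apply Finset.sum_congr rfl
    intro j _
    rw [← Complex.exp_nat_mul]
    push_cast
    ring_nf
  have hre := congrArg Complex.re hs2
  have him := congrArg Complex.im hs2
  rw [Complex.re_sum] at hre
  rw [Complex.im_sum] at him
  simp only [Complex.exp_ofReal_mul_I_re, Complex.exp_ofReal_mul_I_im, Complex.zero_re,
    Complex.zero_im] at hre him
  rw [hre, him]
  simp

theorem fejer_nonneg (θ : ℝ) (q : ℕ) :
    0 ≤ ∑ k ∈ Finset.range q, wt k * ((q : ℝ) - k) * Real.cos (k * θ) := by
  rw [fejer_id]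
  positivity

theorem fejer_at_zero (q : ℕ) :
    ∑ k ∈ Finset.range q, wt k * ((q : ℝ) - k) * Real.cos (k * (0 : ℝ)) = (q : ℝ) ^ 2 := by
  rw [fejer_id]
  simp

theorem beta_sum {x : ℝ} (h0 : 0 ≤ x) (h1 : x ≤ 1) :
    HasSum (fun n : ℕ => 1 / (n : ℝ) ^ 2 * Real.cos (2 * π * n * x))
      (π ^ 2 * (x ^ 2 - x + 1 / 6)) := by
  have h := hasSum_one_div_nat_pow_mul_cos (k := 1) one_ne_zero (x := x) ⟨h0, h1⟩
  convert h using 1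
  simp [Polynomial.bernoulli_def, Finset.sum_range_succ, Polynomial.eval_add]
  ring

theorem cos_ge (q n : ℕ) (hodd : Odd q) :
    -Real.cos (π / q) ≤ Real.cos (2 * π * n / q) := by
  have hq : 0 < q := hodd.pos
  have hqr : (0 : ℝ) < q := by exact_mod_cast hq
  set r := n % q with hr
  have hrq : r < q := Nat.mod_lt _ hq
  have hn : (n : ℝ) = q * (n / q : ℕ) + r := by
    exact_mod_cast (Nat.div_add_mod n q).symm
  have e1 : Real.cos (2 * π * n / q) = Real.cos (2 * π * r / q) := by
    rw [← Real.cos_add_nat_mul_two_pi (2 * π * r / q) (n / q), hn]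
    congr 1
    field_simp
    ring
  have e2 : Real.cos (2 * π * r / q) = -Real.cos (|2 * π * r / q - π|) := by
    rw [Real.cos_abs, Real.cos_sub_pi, neg_neg]
  rw [e1, e2, neg_le_neg_iff]
  have e3 : |2 * π * r / q - π| = π / q * |2 * (r : ℝ) - q| := by
    rw [← abs_of_pos (div_pos Real.pi_pos hqr), ← abs_mul]
    congr 1
    field_simp
  have l1 : 1 ≤ |2 * (r : ℝ) - q| := by
    obtain ⟨m, hm⟩ := hodd
    have : (1 : ℤ) ≤ |2 * (r : ℤ) - q| := by
      apply Int.one_le_abs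
      omega
    exact_mod_cast this
  have l2 : |2 * (r : ℝ) - q| ≤ q := by
    have : (r : ℝ) ≤ q := by exact_mod_cast hrq.le
    have : (0 : ℝ) ≤ r := by positivity
    rw [abs_le]
    constructor <;> linarith
  have hp : 0 < π / q := div_pos Real.pi_pos hqr
  apply Real.cos_le_cos_of_nonneg_of_le_pi hp.le
  · rw [e3]
    calc π / q * |2 * (r : ℝ) - q| ≤ π / q * q := by gcongr
      _ = π := by field_simp
  · rw [e3]
    nlinarith

noncomputable def optA (q : ℕ) : ℝ := (1 + 1 / Real.cos (π / q)) / q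

theorem c0_pos (q : ℕ) (hq : 5 ≤ q) : 0 < Real.cos (π / q) := by
  have hqr : (5 : ℝ) ≤ q := by exact_mod_cast hq
  have : π / q ≤ π / 5 := by gcongr
  have h2 : 0 < π / q := by positivity
  apply Real.cos_pos_of_mem_Ioo
  constructor <;> linarith [Real.pi_pos]

noncomputable def optT (q m : ℕ) : ℕ →₀ ℝ :=
  Finsupp.onFinset (Finset.range q)
    (fun k => if k < q then wt k * ((q : ℝ) - k) / q ^ 2 *
      (1 + Real.cos (k * (2 * π * m / q)) / Real.cos (π / q)) else 0)
    (by
      intro k hk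
      by_contra h
      simp at h
      simp [not_lt.mpr h] at hk)

theorem optT_apply (q m k : ℕ) (hk : k < q) :
    optT q m k = wt k * ((q : ℝ) - k) / q ^ 2 *
      (1 + Real.cos (k * (2 * π * m / q)) / Real.cos (π / q)) := by
  simp [optT, hk]

theorem optT_eval (q m : ℕ) (x : ℝ) :
    trigEval (optT q m) x =
      1 / (q : ℝ) ^ 2 * (∑ k ∈ Finset.range q, wt k * ((q : ℝ) - k) * Real.cos (k * (2 * π * x)))
      + 1 / (2 * (q : ℝ) ^ 2 * Real.cos (π / q)) *
        ((∑ k ∈ Finset.range q, wt k * ((q : ℝ) - k) * Real.cos (k * (2 * π * x + 2 * π * m / q)))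
        + (∑ k ∈ Finset.range q,
            wt k * ((q : ℝ) - k) * Real.cos (k * (2 * π * x - 2 * π * m / q)))) := by
  unfold trigEval
  have hsup : (optT q m).support ⊆ Finset.range q := Finsupp.support_onFinset_subset
  rw [Finsupp.sum_of_support_subset (s := Finset.range q) _ hsup _ (by simp)]
  rw [← Finset.sum_add_distrib, Finset.mul_sum, Finset.mul_sum, ← Finset.sum_add_distrib]
  apply Finset.sum_congr rfl
  intro k hk
  rw [optT_apply _ _ _ (Finset.mem_range.mp hk)]
  have e : (2 * π * k * x) = k * (2 * π * x) := by ring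
  rw [e, mul_add (k : ℝ) (2 * π * x), mul_sub (k : ℝ) (2 * π * x), Real.cos_add, Real.cos_sub]
  by_cases hc : Real.cos (π / q) = 0
  · simp [hc]
    ring
  by_cases hq : (q : ℝ) = 0
  · simp [hq]
  field_simp
  ring

theorem cos_phi (m : ℕ) :
    Real.cos (2 * π * m / ((2 * m + 1 : ℕ) : ℝ)) = -Real.cos (π / ((2 * m + 1 : ℕ) : ℝ)) := by
  rw [← Real.cos_pi_sub]
  congr 1
  push_cast
  field_simp
  ring

theorem optT_mem (q : ℕ) (hq : 5 ≤ q) (hodd : Odd q) :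
    optA q ∈ (fun c : ℕ →₀ ℝ => c 0) '' TrigClass (Kset0 2 q) := by
  obtain ⟨m, hm⟩ := hodd
  have hc := c0_pos q hq
  have hqr : (0 : ℝ) < q := by positivity
  have hphi : Real.cos (2 * π * m / q) = -Real.cos (π / q) := by
    rw [hm]
    exact cos_phi m
  refine ⟨optT q m, ⟨?_, ?_, ?_⟩, ?_⟩
  · intro k hk0 hk
    by_cases hkq : k < q
    · rw [optT_apply _ _ _ hkq] at hk
      refine ⟨?_, ?_⟩
      · by_contra h
        have : k = 1 := by omega
        subst this
        apply hk
        rw [Nat.cast_one, one_mul, hphi, neg_div, div_self hc.ne']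
        simp
      · by_contra h
        have : k = q - 1 := by omega
        apply hk
        have e : (k : ℝ) = q - 1 := by
          rw [this, Nat.cast_sub (by omega), Nat.cast_one]
        have e2 : (k : ℝ) * (2 * π * m / q) = m * (2 * π) - 2 * π * m / q := by
          rw [e]
          field_simp
        rw [e2, Real.cos_nat_mul_two_pi_sub, hphi, neg_div, div_self hc.ne']
        simp
    · exfalso
      apply hk
      simp [optT, hkq]
  · intro x
    rw [optT_eval]
    have := fejer_nonneg (2 * π * x) q
    have := fejer_nonneg (2 * π * x + 2 * π * m / q) q
    have := fejer_nonneg (2 * π * x - 2 * π * m / q) q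
    positivity
  · rw [optT_eval]
    have z1 := fejer_zero (2 * π * m / q) q (by rw [hphi]; linarith) ⟨m, by field_simp⟩
    have z0 := fejer_at_zero q
    simp only [mul_zero, zero_add, zero_sub, mul_neg, Real.cos_neg] at z0 ⊢
    rw [z1, z0]
    field_simp
    simp
  · show optT q m 0 = optA q
    rw [optT_apply _ _ _ (by omega)]
    simp [wt, optA]
    field_simp

noncomputable def optF (q : ℕ) (n : ℕ) : ℝ :=
  (if n = 0 then optA q else 0) + q / π ^ 2 * (1 / (n : ℝ) ^ 2) *
    ((1 - Real.cos (2 * π * n / q)) * (1 + Real.cos (2 * π * n / q) / Real.cos (π / q)))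

theorem optF_hasSum (q : ℕ) (hq : 5 ≤ q) (x b0 b1 b1' b2 b2' : ℝ)
    (h0 : HasSum (fun n : ℕ => 1 / (n : ℝ) ^ 2 * Real.cos (2 * π * n * x)) b0)
    (h1 : HasSum (fun n : ℕ => 1 / (n : ℝ) ^ 2 * Real.cos (2 * π * n * (x + 1 / q))) b1)
    (h1' : HasSum (fun n : ℕ => 1 / (n : ℝ) ^ 2 * Real.cos (2 * π * n * (x - 1 / q))) b1')
    (h2 : HasSum (fun n : ℕ => 1 / (n : ℝ) ^ 2 * Real.cos (2 * π * n * (x + 2 / q))) b2)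
    (h2' : HasSum (fun n : ℕ => 1 / (n : ℝ) ^ 2 * Real.cos (2 * π * n * (x - 2 / q))) b2') :
    HasSum (fun n : ℕ => optF q n * Real.cos (2 * π * n * x))
      (optA q + q / π ^ 2 * ((1 - 1 / (2 * Real.cos (π / q))) * b0
        + (1 / Real.cos (π / q) - 1) / 2 * (b1 + b1')
        - 1 / (4 * Real.cos (π / q)) * (b2 + b2'))) := by
  have hc := c0_pos q hq
  have hqr : (0 : ℝ) < q := by positivity
  have hd := hasSum_ite_eq (0 : ℕ) (optA q)
  have := hd.add ((((h0.mul_left (1 - 1 / (2 * Real.cos (π / q)))).add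
    ((h1.add h1').mul_left ((1 / Real.cos (π / q) - 1) / 2))).sub
    ((h2.add h2').mul_left (1 / (4 * Real.cos (π / q))))).mul_left (q / π ^ 2))
  convert this using 1
  ext n
  have e1 : 2 * π * n * (x + 1 / q) = 2 * π * n * x + 2 * π * n / q := by ring
  have e1' : 2 * π * n * (x - 1 / q) = 2 * π * n * x - 2 * π * n / q := by ring
  have e2 : 2 * π * n * (x + 2 / q) = 2 * π * n * x + 2 * (2 * π * n / q) := by ring
  have e2' : 2 * π * n * (x - 2 / q) = 2 * π * n * x - 2 * (2 * π * n / q) := by ring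
  rw [e1, e1', e2, e2', Real.cos_add, Real.cos_sub, Real.cos_add, Real.cos_sub,
    Real.cos_two_mul]
  unfold optF
  by_cases hn : n = 0
  · subst hn
    simp
  · simp only [if_neg hn, zero_add]
    field_simp
    ring

theorem optF_zero (q : ℕ) (hq : 5 ≤ q) (x : ℝ) (hx : 2 / (q : ℝ) ≤ x) (hx2 : x ≤ 1 / 2) :
    HasSum (fun n : ℕ => optF q n * Real.cos (2 * π * n * x)) 0 := by
  have hc := c0_pos q hq
  have hqr : (5 : ℝ) ≤ q := by exact_mod_cast hq
  have hq0 : (0 : ℝ) < q := by positivity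
  have i1 : (0 : ℝ) < 1 / q := by positivity
  have i2 : 2 / (q : ℝ) = 2 * (1 / q) := by ring
  have i3 : 1 / (q : ℝ) ≤ 1 / 5 := by gcongr
  have := optF_hasSum q hq x _ _ _ _ _
    (beta_sum (x := x) (by linarith) (by linarith))
    (beta_sum (x := x + 1 / q) (by linarith) (by linarith))
    (beta_sum (x := x - 1 / q) (by linarith) (by linarith))
    (beta_sum (x := x + 2 / q) (by linarith) (by linarith))
    (beta_sum (x := x - 2 / q) (by linarith) (by linarith))
  convert this using 1
  unfold optA
  field_simp
  ring

theorem optF_one (q : ℕ) (hq : 5 ≤ q) : HasSum (optF q) 1 := by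
  have hc := c0_pos q hq
  have hqr : (5 : ℝ) ≤ q := by exact_mod_cast hq
  have hq0 : (0 : ℝ) < q := by positivity
  have i1 : (0 : ℝ) < 1 / q := by positivity
  have i2 : 2 / (q : ℝ) = 2 * (1 / q) := by ring
  have i3 : 1 / (q : ℝ) ≤ 1 / 5 := by gcongr
  have h0 := beta_sum (x := 0) (by linarith) (by linarith)
  have h1 := beta_sum (x := 1 / q) (by linarith) (by linarith)
  have h2 := beta_sum (x := 2 / q) (by linarith) (by linarith)
  have := optF_hasSum q hq 0 _ _ _ _ _ h0 (by simpa only [zero_add] using h1)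
    (by simpa only [zero_sub, mul_neg, Real.cos_neg] using h1)
    (by simpa only [zero_add] using h2)
    (by simpa only [zero_sub, mul_neg, Real.cos_neg] using h2)
  simp only [mul_zero, Real.cos_zero, mul_one] at this
  convert this using 1
  unfold optA
  field_simp
  ring

theorem optF_mem (q : ℕ) (hq : 5 ≤ q) (hodd : Odd q) :
    optA q ∈ (fun a : ℕ → ℝ => a 0) '' TuranClass (2 / q) := by
  have hc := c0_pos q hq
  have hq0 : (0 : ℝ) < q := by positivity
  refine ⟨optF q, ⟨?_, (optF_one q hq).summable, (optF_one q hq).tsum_eq, ?_⟩, ?_⟩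
  · intro n
    unfold optF
    have a1 : 0 ≤ 1 - Real.cos (2 * π * n / q) := by linarith [Real.cos_le_one (2 * π * n / q)]
    have a2 : 0 ≤ 1 + Real.cos (2 * π * n / q) / Real.cos (π / q) := by
      have := cos_ge q n hodd
      have h3 : -1 ≤ Real.cos (2 * π * n / q) / Real.cos (π / q) := by
        rw [le_div_iff₀ hc]
        linarith
      linarith
    have a3 : 0 ≤ (if n = 0 then optA q else 0) := by
      split_ifs
      · unfold optA
        positivity
      · exact le_rfl
    positivity
  · intro x hx hx2
    have := (optF_zero q hq |x| hx hx2).tsum_eq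
    rw [← this]
    apply tsum_congr
    intro n
    congr 1
    rcases abs_choice x with h | h <;> rw [h]
    rw [mul_neg, Real.cos_neg]
  · simp [optF]

theorem weak_duality (q : ℕ) (hq : 5 ≤ q) (c : ℕ →₀ ℝ) (hc : c ∈ TrigClass (Kset 2 q))
    (a : ℕ → ℝ) (ha : a ∈ TuranClass (2 / q)) : a 0 ≤ c 0 := by
  obtain ⟨hK, hpos, hone⟩ := hc
  obtain ⟨ha0, has, ha1, haz⟩ := ha
  have hq0 : (0 : ℝ) < q := by positivity
  have hsum : ∀ x : ℝ, Summable (fun n : ℕ => a n * Real.cos (2 * π * n * x)) := by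
    intro x
    apply Summable.of_norm_bounded has
    intro n
    rw [norm_mul, Real.norm_of_nonneg (ha0 n)]
    exact mul_le_of_le_one_right (ha0 n) (Real.abs_cos_le_one _)
  have hval : ∀ k ∈ c.support,
      HasSum (fun n : ℕ => a n * (c k * Real.cos (2 * π * k * (n / q)))) (if k = 0 then c 0 else 0) := by
    intro k hk
    by_cases hk0 : k = 0
    · subst hk0
      have := (has.hasSum.mul_right (c 0))
      rw [ha1] at this
      simpa using this
    · rw [if_neg hk0]
      obtain ⟨ν, k', hkk, h1, h2⟩ := hK k hk0 (Finsupp.mem_support_iff.mp hk)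
      have key : ∃ y : ℝ, 2 / (q : ℝ) ≤ |y| ∧ |y| ≤ 1 / 2 ∧
          ∀ n : ℕ, Real.cos (2 * π * k * (n / q)) = Real.cos (2 * π * n * y) := by
        have h1r : (2 : ℝ) ≤ k' := by exact_mod_cast h1
        have h2r : (k' : ℝ) + 2 ≤ q := by
          have : k' + 2 ≤ q := by omega
          exact_mod_cast this
        have hkr : (k : ℝ) = q * ν + k' := by exact_mod_cast hkk
        by_cases hh : 2 * k' ≤ q
        · have hhr : 2 * (k' : ℝ) ≤ q := by exact_mod_cast hh
          refine ⟨k' / q, ?_, ?_, ?_⟩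
          · rw [abs_of_nonneg (by positivity)]
            gcongr
          · rw [abs_of_nonneg (by positivity), div_le_div_iff₀ hq0 (by norm_num)]
            linarith
          · intro n
            rw [← Real.cos_add_nat_mul_two_pi (2 * π * n * (k' / q)) (ν * n), hkr]
            congr 1
            push_cast
            field_simp
            ring
        · have hhr : (q : ℝ) ≤ 2 * k' := by
            have : q ≤ 2 * k' := by omega
            exact_mod_cast this
          refine ⟨(q - k') / q, ?_, ?_, ?_⟩
          · rw [abs_of_nonneg (div_nonneg (by linarith) hq0.le)]
            gcongr
            linarith
          · rw [abs_of_nonneg (div_nonneg (by linarith) hq0.le),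
              div_le_div_iff₀ hq0 (by norm_num)]
            linarith
          · intro n
            rw [← Real.cos_nat_mul_two_pi_sub (2 * π * n * ((q - k') / q)) ((ν + 1) * n), hkr]
            congr 1
            push_cast
            field_simp
            ring
      obtain ⟨y, hy1, hy2, hy⟩ := key
      have h := (hsum y).hasSum.mul_left (c k)
      rw [haz y hy1 hy2, mul_zero] at h
      have ee : (fun n : ℕ => a n * (c k * Real.cos (2 * π * k * (n / q))))
          = fun n : ℕ => c k * (a n * Real.cos (2 * π * n * y)) := by
        funext n
        rw [hy n]
        ring
      rw [ee]
      exact h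
  have htot := hasSum_sum hval
  have e1 : ∑ k ∈ c.support, (if k = 0 then c 0 else 0) = c 0 := by
    rw [Finset.sum_ite_eq']
    split_ifs with h
    · rfl
    · exact (Finsupp.notMem_support_iff.mp h).symm
  rw [e1] at htot
  have e2 : (fun n : ℕ => ∑ k ∈ c.support, a n * (c k * Real.cos (2 * π * k * (n / q))))
      = fun n : ℕ => a n * trigEval c (n / q) := by
    ext n
    rw [← Finset.mul_sum]
    rfl
  rw [e2] at htot
  have := le_hasSum htot 0 (fun n _ => mul_nonneg (ha0 n) (hpos _))
  simpa [hone] using this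

theorem Kset0_subset (q : ℕ) : TrigClass (Kset0 2 q) ⊆ TrigClass (Kset 2 q) := by
  rintro c ⟨h1, h2⟩
  refine ⟨?_, h2⟩
  intro k hk hck
  obtain ⟨h3, h4⟩ := h1 k hk hck
  exact ⟨0, k, by simp, h3, h4⟩

/-- Theorem 1, case `p = 2`:  `δ(K⁰_{2,q}) = δ(K_{2,q}) = A(2/q)` for odd `q ≥ 5`. -/
theorem stmt_2 (q : ℕ) (hq : 5 ≤ q) (hodd : Odd q) :
    delta (Kset0 2 q) = turanA (2 / q) ∧ delta (Kset 2 q) = turanA (2 / q) := by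
  obtain ⟨c, hc, hc0⟩ := optT_mem q hq hodd
  obtain ⟨a, ha, ha0⟩ := optF_mem q hq hodd
  have hA : turanA (2 / q) = optA q := by
    apply IsGreatest.csSup_eq
    refine ⟨⟨a, ha, ha0⟩, ?_⟩
    rintro _ ⟨b, hb, rfl⟩
    rw [← hc0]
    exact weak_duality q hq c (Kset0_subset q hc) b hb
  rw [hA]
  constructor
  · apply IsLeast.csInf_eq
    refine ⟨⟨c, hc, hc0⟩, ?_⟩
    rintro _ ⟨b, hb, rfl⟩
    rw [← ha0]
    exact weak_duality q hq b (Kset0_subset q hb) a ha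
  · apply IsLeast.csInf_eq
    refine ⟨⟨c, Kset0_subset q hc, hc0⟩, ?_⟩
    rintro _ ⟨b, hb, rfl⟩
    rw [← ha0]
    exact weak_duality q hq b hb a ha
end

section
/- Let q be an odd integer with q ≥ 5. Then δ(K⁰_{2,q}) = δ(K_{2,q}) = (1 + cos(π/q))/(q·cos(π/q)), where K⁰_{2,q} = {2, 3, …, q−2} and K_{2,q} = {qν + k : ν ∈ ℤ_{≥0}, k ∈ K⁰_{2,q}}. -/
open Real

lemma aux_orth (q : ℕ) (hq : 0 < q) (k : ℤ) :
    ∑ j ∈ Finset.range q, Real.cos (2 * π * k * ((j : ℝ) / q)) =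
      if (q : ℤ) ∣ k then (q : ℝ) else 0 := by
  have hq0 : (q : ℝ) ≠ 0 := by positivity
  have hq0' : (q : ℂ) ≠ 0 := by exact_mod_cast hq.ne'
  have hz := Complex.isPrimitiveRoot_exp q hq.ne'
  set ζ := Complex.exp (2 * π * Complex.I / q) with hζ
  have hterm : ∀ j : ℕ, Real.cos (2 * π * k * ((j : ℝ) / q)) = ((ζ ^ k) ^ j).re := by
    intro j
    rw [← Complex.exp_ofReal_mul_I_re, hζ, ← Complex.exp_int_mul, ← Complex.exp_nat_mul]
    congr 2
    push_cast
    field_simp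
  simp_rw [hterm]
  rw [← Complex.re_sum]
  split_ifs with h
  · have : ζ ^ k = 1 := (hz.zpow_eq_one_iff_dvd k).2 h
    simp [this]
  · have h1 : ζ ^ k ≠ 1 := fun h' => h ((hz.zpow_eq_one_iff_dvd k).1 h')
    have h2 : (ζ ^ k) ^ q = 1 := by
      rw [← zpow_natCast, ← zpow_mul, mul_comm, zpow_mul, zpow_natCast, hz.pow_eq_one, one_zpow]
    rw [geom_sum_eq h1, h2]
    simp

lemma aux_quad (q : ℕ) (hq : 0 < q) (c : ℕ →₀ ℝ) (α β : ℝ) :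
    ∑ j ∈ Finset.range q, trigEval c ((j : ℝ) / q) * (α + β * Real.cos (2 * π * ((j : ℝ) / q)))
    = c.sum fun k a => a * (α * (if (q : ℤ) ∣ (k : ℤ) then (q : ℝ) else 0) +
        β / 2 * ((if (q : ℤ) ∣ (k : ℤ) + 1 then (q : ℝ) else 0) +
          (if (q : ℤ) ∣ (k : ℤ) - 1 then (q : ℝ) else 0))) := by
  simp only [trigEval, Finsupp.sum, Finset.sum_mul]
  rw [Finset.sum_comm]
  refine Finset.sum_congr rfl fun k _ => ?_
  rw [← aux_orth q hq, ← aux_orth q hq, ← aux_orth q hq, ← Finset.sum_add_distrib,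
    Finset.mul_sum, Finset.mul_sum, ← Finset.sum_add_distrib, Finset.mul_sum]
  refine Finset.sum_congr rfl fun j _ => ?_
  have e1 : 2 * π * (((k : ℤ) + 1 : ℤ) : ℝ) * ((j : ℝ) / q)
      = 2 * π * k * ((j : ℝ) / q) + 2 * π * ((j : ℝ) / q) := by push_cast; ring
  have e2 : 2 * π * (((k : ℤ) - 1 : ℤ) : ℝ) * ((j : ℝ) / q)
      = 2 * π * k * ((j : ℝ) / q) - 2 * π * ((j : ℝ) / q) := by push_cast; ring
  rw [e1, e2, Real.cos_add, Real.cos_sub]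
  push_cast
  ring

/-- quadrature for the class -/
lemma aux_quadK (q : ℕ) (hq : 5 ≤ q) (c : ℕ →₀ ℝ)
    (hc : ∀ k : ℕ, k ≠ 0 → c k ≠ 0 → k ∈ Kset 2 q) (β : ℝ) :
    ∑ j ∈ Finset.range q, trigEval c ((j : ℝ) / q) * (1 + β * Real.cos (2 * π * ((j : ℝ) / q)))
    = q * c 0 := by
  rw [aux_quad q (by omega) c 1 β, Finsupp.sum, Finset.sum_eq_single 0]
  · have h1 : ¬ (q : ℤ) ∣ (1 : ℤ) := by
      intro h; have := Int.le_of_dvd (by norm_num) h; omega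
    simp [h1, show q ≠ 1 by omega]
    ring
  · intro k hk hk0
    obtain ⟨ν, k', rfl, h2, h3⟩ := hc k hk0 (Finsupp.mem_support_iff.1 hk)
    have key : ∀ r : ℤ, 0 < r → r < q → ∀ n : ℤ, n = q * ν + r → ¬ (q : ℤ) ∣ n := by
      rintro r hr hr' n rfl h
      have h4 : (q : ℤ) ∣ r := (Int.dvd_add_right (Dvd.intro _ rfl)).1 h
      have := Int.le_of_dvd hr h4
      omega
    rw [if_neg (key k' (by omega) (by omega) _ (by push_cast; ring)),
      if_neg (key (k' + 1) (by omega) (by omega) _ (by push_cast; ring)),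
      if_neg (key (k' - 1) (by omega) (by omega) _ (by push_cast; ring))]
    simp
  · intro h
    simp [Finsupp.notMem_support_iff.1 h]

lemma aux_cpos (q : ℕ) (hq : 5 ≤ q) : 0 < Real.cos (π / q) ∧ Real.cos (π / q) < 1 := by
  have hq' : (5 : ℝ) ≤ q := by exact_mod_cast hq
  have h1 : 0 < π / q := by positivity
  have h2 : π / q < π / 2 := by
    apply div_lt_div_of_pos_left pi_pos <;> linarith
  refine ⟨Real.cos_pos_of_mem_Ioo ⟨by linarith, h2⟩, ?_⟩
  rw [← Real.cos_zero]
  exact Real.cos_lt_cos_of_nonneg_of_le_pi_div_two le_rfl h2.le h1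

lemma aux_cosge (m j : ℕ) (hj : j < 2 * m + 1) :
    - Real.cos (π / (2 * m + 1 : ℕ)) ≤ Real.cos (2 * π * ((j : ℝ) / (2 * m + 1 : ℕ))) := by
  set q : ℕ := 2 * m + 1 with hq
  have hq0 : (0 : ℝ) < q := by simp [hq]; positivity
  have hqm : (q : ℝ) = 2 * m + 1 := by simp [hq]
  rw [← Real.cos_pi_sub]
  have e : π - π / q = π * (2 * m / q) := by field_simp; rw [hqm]; ring
  have hle1 : π * (2 * m / q) ≤ π := by
    rw [← e]; have : 0 < π / q := by positivity
    linarith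
  rw [e]
  rcases Nat.lt_or_ge m j with h | h
  · have e2 : Real.cos (2 * π * ((j : ℝ) / q)) = Real.cos (π * (2 * (q - j : ℝ) / q)) := by
      rw [← Real.cos_two_pi_sub]; congr 1; field_simp
    have hj1 : (j : ℝ) ≤ q := by exact_mod_cast hj.le
    have hj2 : (m : ℝ) + 1 ≤ j := by exact_mod_cast h
    rw [e2]
    apply Real.cos_le_cos_of_nonneg_of_le_pi
    · have : 0 ≤ (q - j : ℝ) := by linarith
      positivity
    · exact hle1
    · gcongr
      linarith
  · have hj2 : (j : ℝ) ≤ m := by exact_mod_cast h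
    have e2 : 2 * π * ((j : ℝ) / q) = π * (2 * j / q) := by ring
    rw [e2]
    apply Real.cos_le_cos_of_nonneg_of_le_pi
    · positivity
    · exact hle1
    · gcongr

lemma aux_lower (q : ℕ) (hq : 5 ≤ q) (hodd : Odd q) (c : ℕ →₀ ℝ) (hc : c ∈ TrigClass (Kset 2 q)) :
    (1 + Real.cos (π / q)) / (q * Real.cos (π / q)) ≤ c 0 := by
  obtain ⟨h1, h2, h3⟩ := hc
  obtain ⟨hp, hl⟩ := aux_cpos q hq
  have hq0 : (0 : ℝ) < q := by positivity
  have := aux_quadK q hq c h1 (1 / Real.cos (π / q))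
  have h0 : trigEval c (((0 : ℕ) : ℝ) / q) * (1 + 1 / Real.cos (π / q) * Real.cos (2 * π * (((0 : ℕ) : ℝ) / q)))
      ≤ ∑ j ∈ Finset.range q, trigEval c ((j : ℝ) / q) * (1 + 1 / Real.cos (π / q) * Real.cos (2 * π * ((j : ℝ) / q))) := by
    apply Finset.single_le_sum (f := fun j : ℕ => trigEval c ((j : ℝ) / q) * (1 + 1 / Real.cos (π / q) * Real.cos (2 * π * ((j : ℝ) / q)))) _ (Finset.mem_range.2 (by omega))
    intro j hj
    apply mul_nonneg (h2 _)
    obtain ⟨m, rfl⟩ := hodd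
    have := aux_cosge m j (Finset.mem_range.1 hj)
    have e : 1 + 1 / Real.cos (π / (2 * m + 1 : ℕ)) * Real.cos (2 * π * ((j : ℝ) / (2 * m + 1 : ℕ)))
      = (Real.cos (π / (2 * m + 1 : ℕ)) + Real.cos (2 * π * ((j : ℝ) / (2 * m + 1 : ℕ)))) / Real.cos (π / (2 * m + 1 : ℕ)) := by
      field_simp
    rw [e]
    apply div_nonneg _ hp.le
    linarith
  rw [this] at h0
  simp only [Nat.cast_zero, zero_div, mul_zero, Real.cos_zero, h3] at h0
  rw [div_le_iff₀ (by positivity)]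
  have e : (1 + Real.cos (π / q)) = (1 * (1 + 1 / Real.cos (π / q) * 1)) * Real.cos (π / q) := by
    field_simp
    ring
  rw [e]
  nlinarith

/-- cosine polynomials of degree at most `d` -/
noncomputable def cosSpan (d : ℕ) : Submodule ℝ (ℝ → ℝ) :=
  Submodule.span ℝ ((fun (k : ℕ) (x : ℝ) => Real.cos (2 * π * k * x)) '' {k | k ≤ d})

lemma cosSpan_mono {d e : ℕ} (h : d ≤ e) : cosSpan d ≤ cosSpan e := by
  apply Submodule.span_mono
  apply Set.image_mono
  intro k hk
  exact le_trans hk h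

lemma cosSpan_basis {k d : ℕ} (h : k ≤ d) : (fun x : ℝ => Real.cos (2 * π * k * x)) ∈ cosSpan d :=
  Submodule.subset_span ⟨k, h, rfl⟩

lemma cosSpan_mul {d : ℕ} {f : ℝ → ℝ} (hf : f ∈ cosSpan d) :
    (fun x => f x * Real.cos (2 * π * x)) ∈ cosSpan (d + 1) := by
  induction hf using Submodule.span_induction with
  | mem f h =>
    obtain ⟨k, hk, rfl⟩ := h
    have hk : k ≤ d := hk
    rcases k with _ | k
    · convert cosSpan_basis (k := 1) (d := d + 1) (by omega) using 2
      simp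
    · have e : (fun x : ℝ => Real.cos (2 * π * (k + 1 : ℕ) * x) * Real.cos (2 * π * x)) =
        (1 / 2 : ℝ) • ((fun x : ℝ => Real.cos (2 * π * (k + 2 : ℕ) * x)) +
          (fun x : ℝ => Real.cos (2 * π * k * x))) := by
        funext x
        have e1 : 2 * π * (k + 2 : ℕ) * x = 2 * π * (k + 1 : ℕ) * x + 2 * π * x := by
          push_cast; ring
        have e2 : 2 * π * k * x = 2 * π * (k + 1 : ℕ) * x - 2 * π * x := by
          push_cast; ring
        simp only [Pi.smul_apply, Pi.add_apply, smul_eq_mul]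
        rw [e1, e2, Real.cos_add, Real.cos_sub]
        ring
      show (fun x : ℝ => Real.cos (2 * π * (k + 1 : ℕ) * x) * Real.cos (2 * π * x)) ∈ _
      rw [e]
      exact Submodule.smul_mem _ _ (Submodule.add_mem _ (cosSpan_basis (by omega)) (cosSpan_basis (by omega)))
  | zero =>
    convert (cosSpan (d + 1)).zero_mem using 1
    funext x; simp
  | add f g _ _ hf hg =>
    convert (cosSpan (d + 1)).add_mem hf hg using 1
    funext x; simp [add_mul]
  | smul a f _ hf =>
    convert (cosSpan (d + 1)).smul_mem a hf using 1
    funext x; simp [mul_assoc]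

lemma cosSpan_lin {d : ℕ} {f : ℝ → ℝ} (hf : f ∈ cosSpan d) (a b : ℝ) :
    (fun x => f x * (a + b * Real.cos (2 * π * x))) ∈ cosSpan (d + 1) := by
  convert (cosSpan (d + 1)).add_mem ((cosSpan (d + 1)).smul_mem a (cosSpan_mono (Nat.le_succ d) hf))
    ((cosSpan (d + 1)).smul_mem b (cosSpan_mul hf)) using 1
  funext x; simp; ring

lemma cosSpan_prod (z : ℕ → ℝ) (n : ℕ) :
    (fun x => ∏ i ∈ Finset.range n, (Real.cos (2 * π * x) - z i) ^ 2) ∈ cosSpan (2 * n) := by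
  induction n with
  | zero =>
    convert cosSpan_basis (k := 0) (d := 0) le_rfl using 2
    simp
  | succ n ih =>
    rw [show 2 * (n + 1) = 2 * n + 1 + 1 by ring]
    convert cosSpan_lin (cosSpan_lin ih (-z n) 1) (-z n) 1 using 1
    funext x
    rw [Finset.prod_range_succ]
    ring

lemma cosSpan_coeff {d : ℕ} {f : ℝ → ℝ} (hf : f ∈ cosSpan d) :
    ∃ c : ℕ →₀ ℝ, (∀ k, d < k → c k = 0) ∧ ∀ x, trigEval c x = f x := by
  obtain ⟨c, hc, rfl⟩ := (Finsupp.mem_span_image_iff_linearCombination ℝ).1 hf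
  refine ⟨c, fun k hk => ?_, fun x => ?_⟩
  · by_contra h
    have := (Finsupp.mem_supported ℝ c).1 hc (Finsupp.mem_support_iff.2 h)
    have : k ≤ d := this
    omega
  · rw [Finsupp.linearCombination_apply]
    simp [trigEval, Finsupp.sum, Finset.sum_apply]

/-- telescoping ratio -/
lemma aux_ratio (n : ℕ) (q : ℕ) (hq : q = 2 * (n + 1) + 1) :
    (∏ i ∈ Finset.range n, (1 - Real.cos (2 * π * ((i + 1 : ℕ) / (q : ℝ)))) ^ 2)
      * ((1 + Real.cos (π / q)) / 2) =
    (∏ i ∈ Finset.range n, (- Real.cos (π / q) - Real.cos (2 * π * ((i + 1 : ℕ) / (q : ℝ)))) ^ 2)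
      * (1 - Real.cos (π / q) ^ 2) := by
  have hqn : (q : ℝ) = 2 * (n + 1) + 1 := by rw [hq]; push_cast; ring
  have hq0 : (0 : ℝ) < q := by rw [hqn]; positivity
  set s : ℕ → ℝ := fun i => Real.sin (π * i / q) with hs
  have h1 : ∀ i : ℕ, 1 - Real.cos (2 * π * ((i + 1 : ℕ) / (q : ℝ))) = 2 * s (i + 1) ^ 2 := by
    intro i
    have : 2 * π * ((i + 1 : ℕ) / (q : ℝ)) = 2 * (π * (i + 1 : ℕ) / q) := by ring
    rw [this, Real.cos_two_mul, hs]
    have := Real.sin_sq_add_cos_sq (π * (i + 1 : ℕ) / q)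
    simp only
    linarith
  have h2 : ∀ i ∈ Finset.range n, (- Real.cos (π / q) - Real.cos (2 * π * ((i + 1 : ℕ) / (q : ℝ)))) ^ 2
      = (2 * s (n - 1 - i + 1) * s (n - 1 - i + 2)) ^ 2 := by
    intro i hi
    have hi := Finset.mem_range.1 hi
    obtain ⟨l, rfl⟩ : ∃ l, n = i + 1 + l := ⟨n - (i + 1), by omega⟩
    have e : i + 1 + l - 1 - i = l := by omega
    rw [e]
    have e3 : Real.cos (π / q) + Real.cos (2 * π * ((i + 1 : ℕ) / (q : ℝ))) = 2 * s (l + 1) * s (l + 2) := by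
      have hnl : (q : ℝ) = 2 * (i + 1 + l + 1) + 1 := by rw [hqn]; push_cast; ring
      have t1 : s (l + 1) = Real.cos ((π / q + 2 * π * ((i + 1 : ℕ) / (q : ℝ))) / 2) := by
        have e1 : π * ((l + 1 : ℕ) : ℝ) / q = π / 2 - (π / q + 2 * π * ((i + 1 : ℕ) / (q : ℝ))) / 2 := by
          push_cast; field_simp; rw [hnl]; ring
        show Real.sin (π * ((l + 1 : ℕ) : ℝ) / q) = _
        rw [e1, Real.sin_pi_div_two_sub]
      have t2 : s (l + 2) = Real.cos ((π / q - 2 * π * ((i + 1 : ℕ) / (q : ℝ))) / 2) := by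
        have e1 : π * ((l + 2 : ℕ) : ℝ) / q = (π / q - 2 * π * ((i + 1 : ℕ) / (q : ℝ))) / 2 + π / 2 := by
          push_cast; field_simp; rw [hnl]; ring
        show Real.sin (π * ((l + 2 : ℕ) : ℝ) / q) = _
        rw [e1, Real.sin_add_pi_div_two]
      rw [t1, t2, Real.cos_add_cos]
    rw [← e3]; ring
  rw [Finset.prod_congr rfl h2, Finset.prod_range_reflect (fun i => (2 * s (i + 1) * s (i + 2)) ^ 2) n]
  simp_rw [h1]
  have hm : (1 + Real.cos (π / q)) / 2 = s (n + 1) ^ 2 := by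
    have := Real.cos_two_mul (π * (n + 1 : ℕ) / q)
    have h := Real.sin_sq_add_cos_sq (π * (n + 1 : ℕ) / q)
    have e : Real.cos (2 * (π * (n + 1 : ℕ) / q)) = - Real.cos (π / q) := by
      rw [← Real.cos_pi_sub]; congr 1; field_simp; rw [hqn]; push_cast; ring
    simp only [hs]
    linarith
  have h0 : 1 - Real.cos (π / q) ^ 2 = s 1 ^ 2 := by
    simp only [hs, Nat.cast_one, mul_one]
    rw [Real.sin_sq]
  rw [hm, h0]
  simp only [mul_pow, Finset.prod_mul_distrib]
  have ht : (∏ i ∈ Finset.range n, s (i + 1) ^ 2) * s (n + 1) ^ 2 =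
      (∏ i ∈ Finset.range n, s (i + 2) ^ 2) * s 1 ^ 2 := by
    rw [← Finset.prod_range_succ (fun i => s (i + 1) ^ 2), Finset.prod_range_succ']
  rw [show ∏ i ∈ Finset.range n, (s (i + 1) ^ 2) ^ 2 = (∏ i ∈ Finset.range n, s (i + 1) ^ 2) * ∏ i ∈ Finset.range n, s (i + 1) ^ 2 by
    rw [← Finset.prod_mul_distrib]; exact Finset.prod_congr rfl fun _ _ => by ring]
  linear_combination (∏ i ∈ Finset.range n, (2 : ℝ) ^ 2) * (∏ i ∈ Finset.range n, s (i + 1) ^ 2) * ht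

lemma aux_upper (q : ℕ) (hq : 5 ≤ q) (hodd : Odd q) :
    ∃ c ∈ TrigClass (Kset0 2 q), c 0 = (1 + Real.cos (π / q)) / (q * Real.cos (π / q)) := by
  obtain ⟨n, hn⟩ : ∃ n, q = 2 * (n + 1) + 1 := by
    obtain ⟨m, rfl⟩ := hodd
    exact ⟨m - 1, by omega⟩
  have hn1 : 1 ≤ n := by omega
  obtain ⟨hp, hl⟩ := aux_cpos q hq
  have hr := aux_ratio n q hn
  have hqn : (q : ℝ) = 2 * (n + 1) + 1 := by rw [hn]; push_cast; ring
  have hq0 : (0 : ℝ) < q := by positivity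
  set C := Real.cos (π / q) with hC
  set z : ℕ → ℝ := fun i => Real.cos (2 * π * ((i + 1 : ℕ) / (q : ℝ))) with hz
  set P : ℝ → ℝ := fun y => ∏ i ∈ Finset.range n, (y - z i) ^ 2 with hP
  have hr' : P 1 * ((1 + C) / 2) = P (-C) * (1 - C ^ 2) := hr
  have hPnn : ∀ y, 0 ≤ P y := fun y => Finset.prod_nonneg fun i _ => sq_nonneg _
  have hP1 : 0 < P 1 := by
    apply Finset.prod_pos
    intro i hi
    have hi := Finset.mem_range.1 hi
    have : z i < 1 := by
      rw [hz, ← Real.cos_zero]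
      have hi' : ((i + 1 : ℕ) : ℝ) ≤ n := by exact_mod_cast hi
      have e : 2 * π * ((i + 1 : ℕ) / (q : ℝ)) = π * (2 * (i + 1 : ℕ) / q) := by ring
      simp only [e]
      apply Real.cos_lt_cos_of_nonneg_of_le_pi le_rfl
      · have : (2 * (i + 1 : ℕ) / (q : ℝ)) ≤ 1 := by
          rw [div_le_one hq0]; linarith
        nlinarith [pi_pos]
      · positivity
    have : 0 < 1 - z i := by linarith
    positivity
  have hPS : P 1 = 2 * (1 - C) * P (-C) := by
    have : (1 + C) ≠ 0 := by linarith
    apply mul_right_cancel₀ this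
    linear_combination 2 * hr'
  have hR : 0 < P (-C) := by
    by_contra h
    have := hPnn (-C)
    have : P (-C) = 0 := by linarith
    rw [this] at hPS
    linarith
  set R := P (-C) with hRdef
  set b : ℝ := 1 / (2 * R * (1 + C)) with hb
  have hbpos : 0 < b := by have : 0 < 1 + C := by linarith
                           positivity
  have hC1 : 0 < 1 - C := by linarith
  set L : ℝ → ℝ := fun y => b * (1 / C + C / (1 - C)) + b * (1 / (1 - C) - 1 / C) * y with hL
  have hLnn : ∀ y, -1 ≤ y → y ≤ 1 → 0 ≤ L y := by
    intro y h1 h2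
    have e : L y = b * ((1 - y) * (1 / C - 1 / 2) + (1 + y) / 2 * ((1 + C) / (1 - C))) := by
      simp only [hL]; field_simp; ring
    rw [e]
    have : 1 ≤ 1 / C := by rw [le_div_iff₀ hp]; linarith
    apply mul_nonneg hbpos.le
    apply add_nonneg
    · apply mul_nonneg <;> linarith
    · apply mul_nonneg
      · linarith
      · apply div_nonneg <;> linarith
  have hL1 : P 1 * L 1 = 1 := by
    have : 1 + C ≠ 0 := by linarith
    simp only [hL]; rw [hPS, hb]; field_simp; ring
  have hLC : P (-C) * L (-C) = 1 / (2 * C) := by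
    have : 1 + C ≠ 0 := by linarith
    rw [← hRdef]
    simp only [hL]; rw [hb]; field_simp; ring
  obtain ⟨c, hc1, hc2⟩ := cosSpan_coeff (cosSpan_lin (cosSpan_prod z n)
    (b * (1 / C + C / (1 - C))) (b * (1 / (1 - C) - 1 / C)))
  have hc2 : ∀ x, trigEval c x = P (Real.cos (2 * π * x)) * L (Real.cos (2 * π * x)) := hc2
  -- values at nodes
  have hsum : ∀ α β : ℝ, ∑ j ∈ Finset.range q, trigEval c ((j : ℝ) / q) * (α + β * Real.cos (2 * π * ((j : ℝ) / q)))
      = α + β + (1 / C) * (α - β * C) := by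
    intro α β
    set g : ℝ → ℝ := fun y => P y * L y * (α + β * y) with hg
    have hcm : Real.cos (2 * π * (((n + 1 : ℕ) : ℝ) / q)) = -C := by
      rw [hC, ← Real.cos_pi_sub]; congr 1; field_simp; rw [hqn]; push_cast; ring
    have hrefl : ∀ j k : ℕ, j + k = q → Real.cos (2 * π * ((j : ℝ) / q)) = Real.cos (2 * π * ((k : ℝ) / q)) := by
      intro j k h
      have : (q : ℝ) = j + k := by exact_mod_cast h.symm
      rw [← Real.cos_two_pi_sub]; congr 1; field_simp; rw [this]; ring
    have hz0 : ∀ j : ℕ, 1 ≤ j → j ≤ n → g (Real.cos (2 * π * ((j : ℝ) / q))) = 0 := by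
      intro j h1 h2
      have : P (Real.cos (2 * π * ((j : ℝ) / q))) = 0 := by
        apply Finset.prod_eq_zero (Finset.mem_range.2 (show j - 1 < n by omega))
        simp only [hz]
        rw [show j - 1 + 1 = j by omega]
        simp
      simp [hg, this]
    have hgm : g (-C) = 1 / (2 * C) * (α - β * C) := by
      simp only [hg]; rw [hLC]; ring
    have hg1 : g 1 = α + β := by
      simp only [hg]; rw [hL1]; ring
    simp_rw [hc2]
    change ∑ j ∈ Finset.range q, g (Real.cos (2 * π * ((j : ℝ) / q))) = _
    have hsub : ({0, n + 1, n + 2} : Finset ℕ) ⊆ Finset.range q := by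
      intro j hj
      simp at hj
      rw [Finset.mem_range]; omega
    rw [← Finset.sum_subset hsub]
    · rw [Finset.sum_insert (by simp), Finset.sum_insert (by simp), Finset.sum_singleton]
      rw [hrefl (n + 2) (n + 1) (by omega), hcm, hgm]
      simp only [Nat.cast_zero, zero_div, mul_zero, Real.cos_zero, hg1]
      field_simp
      ring
    · intro j hj hj'
      have hj := Finset.mem_range.1 hj
      simp at hj'
      rcases Nat.lt_or_ge n j with h | h
      · rw [hrefl j (q - j) (by omega)]
        exact hz0 _ (by omega) (by omega)
      · exact hz0 _ (by omega) (by omega)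
  -- coefficient 1 vanishes
  have hone : c 1 = 0 := by
    have h := hsum 0 1
    rw [aux_quad q (by omega) c 0 1, Finsupp.sum, Finset.sum_eq_single 1] at h
    · have h1 : ¬ (q : ℤ) ∣ (1 + 1 : ℤ) := by
        intro h; have := Int.le_of_dvd (by norm_num) h; omega
      rw [if_neg (c := (q : ℤ) ∣ ((1 : ℕ) : ℤ) + 1) (by exact_mod_cast h1)] at h
      simp at h
      have e : C⁻¹ * C = 1 := inv_mul_cancel₀ hp.ne'
      have h3 : c 1 * (2⁻¹ * (q : ℝ)) = 0 := by linarith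
      rcases mul_eq_zero.1 h3 with h4 | h4
      · exact h4
      · exfalso; linarith
    · intro k hk hk1
      have hkd : k ≤ 2 * n + 1 := by
        by_contra h'
        exact (Finsupp.mem_support_iff.1 hk) (hc1 k (by omega))
      rw [if_neg (c := (q : ℤ) ∣ (k : ℤ) + 1), if_neg (c := (q : ℤ) ∣ (k : ℤ) - 1)]
      · simp
      · intro hd
        rcases Nat.eq_zero_or_pos k with rfl | hk0
        · have hd' : (q : ℤ) ∣ 1 := by simpa using hd
          have := Int.le_of_dvd (by norm_num) hd'; omega
        · have := Int.le_of_dvd (by omega) hd; omega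
      · intro hd
        have := Int.le_of_dvd (by omega) hd; omega
    · intro h
      simp [Finsupp.notMem_support_iff.1 h]
  have hmem : ∀ k : ℕ, k ≠ 0 → c k ≠ 0 → k ∈ Kset0 2 q := by
    intro k hk0 hck
    have hkd : k ≤ 2 * n + 1 := by
      by_contra h'
      exact hck (hc1 k (by omega))
    have : k ≠ 1 := by rintro rfl; exact hck hone
    exact ⟨by omega, by omega⟩
  refine ⟨c, ⟨hmem, ?_, ?_⟩, ?_⟩
  · intro x
    rw [hc2]
    exact mul_nonneg (hPnn _) (hLnn _ (Real.neg_one_le_cos _) (Real.cos_le_one _))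
  · rw [hc2]; simpa using hL1
  · have h := hsum 1 0
    rw [aux_quadK q hq c (fun k hk hck => ⟨0, k, by simp, (hmem k hk hck).1, (hmem k hk hck).2⟩)] at h
    rw [eq_div_iff (by positivity)]
    have e : C * (1 / C) = 1 := by field_simp
    linear_combination C * h + e

/-- Theorem 1, case `p = 2`, closed form:
`δ(K⁰_{2,q}) = δ(K_{2,q}) = (1 + cos(π/q))/(q·cos(π/q))` for odd `q ≥ 5`. -/
theorem stmt_3 (q : ℕ) (hq : 5 ≤ q) (hodd : Odd q) :
    delta (Kset0 2 q) = (1 + Real.cos (π / q)) / (q * Real.cos (π / q)) ∧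
    delta (Kset 2 q) = (1 + Real.cos (π / q)) / (q * Real.cos (π / q)) := by
  have hsub : TrigClass (Kset0 2 q) ⊆ TrigClass (Kset 2 q) := by
    rintro c ⟨h1, h2⟩
    exact ⟨fun k hk hck => ⟨0, k, by simp, (h1 k hk hck).1, (h1 k hk hck).2⟩, h2⟩
  obtain ⟨c, hc, hc0⟩ := aux_upper q hq hodd
  constructor
  · apply IsLeast.csInf_eq
    refine ⟨⟨c, hc, hc0⟩, ?_⟩
    rintro _ ⟨d, hd, rfl⟩
    exact aux_lower q hq hodd d (hsub hd)
  · apply IsLeast.csInf_eq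
    refine ⟨⟨c, hsub hc, hc0⟩, ?_⟩
    rintro _ ⟨d, hd, rfl⟩
    exact aux_lower q hq hodd d hd
end

section
/- Let q ∈ ℕ with q ≥ 7 and gcd(3, q) = 1. Then δ(K⁰_{3,q}) = δ(K_{3,q}) = A(3/q), where K⁰_{3,q} = {3, 4, …, q−3} and K_{3,q} = {qν + k : ν ∈ ℤ_{≥0}, k ∈ K⁰_{3,q}}. -/
open Real

lemma G_eq (n : ℕ) (θ : ℝ) :
    (∑ j ∈ Finset.range n, Real.cos (j * θ)) ^ 2 + (∑ j ∈ Finset.range n, Real.sin (j * θ)) ^ 2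
      = 2 * (∑ k ∈ Finset.range n, ((n : ℝ) - k) * Real.cos (k * θ)) - n := by
  induction n with
  | zero => simp
  | succ n ih =>
    have h1 : ∑ k ∈ Finset.range (n + 1), (((n + 1 : ℕ) : ℝ) - k) * Real.cos (k * θ)
        = ∑ k ∈ Finset.range n, ((n : ℝ) - k) * Real.cos (k * θ)
          + ∑ k ∈ Finset.range (n + 1), Real.cos (k * θ) := by
      have : ∑ k ∈ Finset.range n, ((n : ℝ) - k) * Real.cos (k * θ)
          = ∑ k ∈ Finset.range (n + 1), ((n : ℝ) - k) * Real.cos (k * θ) := by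
        rw [Finset.sum_range_succ]; simp
      rw [this, ← Finset.sum_add_distrib]
      refine Finset.sum_congr rfl fun k _ => ?_
      push_cast; ring
    have h2 : (∑ j ∈ Finset.range n, Real.cos (j * θ)) * Real.cos (n * θ)
        + (∑ j ∈ Finset.range n, Real.sin (j * θ)) * Real.sin (n * θ)
        = ∑ k ∈ Finset.range (n + 1), Real.cos (k * θ) - 1 := by
      rw [Finset.sum_range_succ', Finset.sum_mul, Finset.sum_mul, ← Finset.sum_add_distrib,
        ← Finset.sum_range_reflect]
      simp only [Nat.cast_zero, zero_mul, Real.cos_zero, add_sub_cancel_right]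
      refine Finset.sum_congr rfl fun k hk => ?_
      have hk := Finset.mem_range.1 hk
      have e : ((n - 1 - k : ℕ) : ℝ) = n - 1 - k := by
        rw [Nat.cast_sub (by omega), Nat.cast_sub (by omega)]; simp
      rw [e]
      have : ((k + 1 : ℕ) : ℝ) * θ = n * θ - (n - 1 - k) * θ := by push_cast; ring
      rw [this, Real.cos_sub]; ring
    rw [h1, Finset.sum_range_succ, Finset.sum_range_succ]
    rw [Finset.sum_range_succ] at h2
    push_cast
    nlinarith [Real.sin_sq_add_cos_sq (n * θ)]

noncomputable def GG (n : ℕ) (θ : ℝ) : ℝ :=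
  2 * (∑ k ∈ Finset.range n, ((n : ℝ) - k) * Real.cos (k * θ)) - n

lemma GG_nonneg (n : ℕ) (θ : ℝ) : 0 ≤ GG n θ := by
  rw [GG, ← G_eq]; positivity

lemma GG_zero (n : ℕ) : GG n 0 = n ^ 2 := by
  rw [GG, ← G_eq]; simp

lemma GG_root (n m : ℕ) (hm : 0 < m) (hmn : m < n) : GG n (2 * π * m / n) = 0 := by
  have hn : (n : ℂ) ≠ 0 := by exact_mod_cast (by omega : n ≠ 0)
  set z : ℂ := Complex.exp (((2 * π * m / n : ℝ) : ℂ) * Complex.I) with hz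
  have hz1 : z ≠ 1 := by
    intro h
    have h1 := (Complex.isPrimitiveRoot_exp n (by omega)).pow_ne_one_of_pos_of_lt hm.ne' hmn
    apply h1
    rw [← h, hz, ← Complex.exp_nat_mul]
    congr 1; push_cast; field_simp
  have hzn : z ^ n = 1 := by
    rw [hz, ← Complex.exp_nat_mul, Complex.exp_eq_one_iff]
    refine ⟨m, ?_⟩
    push_cast; field_simp
  have hs : ∑ j ∈ Finset.range n, z ^ j = 0 := by
    rw [geom_sum_eq hz1, hzn]; simp
  have hj : ∀ j : ℕ, z ^ j = Complex.exp (((j * (2 * π * m / n) : ℝ) : ℂ) * Complex.I) := by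
    intro j
    rw [hz, ← Complex.exp_nat_mul]; congr 1; push_cast; ring
  have hre := congrArg Complex.re hs
  have him := congrArg Complex.im hs
  simp only [hj, Complex.re_sum, Complex.im_sum, Complex.exp_ofReal_mul_I_re,
    Complex.exp_ofReal_mul_I_im, Complex.zero_re, Complex.zero_im] at hre him
  rw [GG, ← G_eq, hre, him]; simp

/-- the dual polynomial coefficients -/
noncomputable def dualC (q : ℕ) (a b α β : ℝ) : ℕ →₀ ℝ :=
  Finsupp.onFinset (Finset.range q)
    (fun k => if k < q then (if k = 0 then 1 else 2) * (((q : ℝ) - k) / q ^ 2) *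
      (1 + a * Real.cos (k * α) + b * Real.cos (k * β)) else 0)
    (by intro k hk; by_contra h; simp only [Finset.mem_range] at h; simp [h] at hk)

lemma dualC_eval (q : ℕ) (hq : 0 < q) (a b α β x : ℝ) :
    trigEval (dualC q a b α β) x =
      (GG q (2 * π * x) + a / 2 * (GG q (2 * π * x + α) + GG q (2 * π * x - α))
        + b / 2 * (GG q (2 * π * x + β) + GG q (2 * π * x - β))) / q ^ 2 := by
  have hq' : (q : ℝ) ≠ 0 := by positivity
  unfold trigEval dualC
  rw [Finsupp.onFinset_sum _ (by simp)]
  have : ∀ k ∈ Finset.range q, (if k < q then (if k = 0 then (1:ℝ) else 2) * (((q : ℝ) - k) / q ^ 2) *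
      (1 + a * Real.cos (k * α) + b * Real.cos (k * β)) else 0) * Real.cos (2 * π * k * x)
      = 2 * (((q : ℝ) - k) / q ^ 2) * (1 + a * Real.cos (k * α) + b * Real.cos (k * β)) * Real.cos (k * (2 * π * x))
       - (if k = 0 then (1 + a + b) / q else 0) := by
    intro k hk
    rw [if_pos (Finset.mem_range.1 hk), show 2 * π * k * x = k * (2 * π * x) by ring]
    rcases Nat.eq_zero_or_pos k with h | h
    · subst h; simp; field_simp; ring
    · simp [h.ne']
  rw [Finset.sum_congr rfl this, Finset.sum_sub_distrib, Finset.sum_ite_eq' , if_pos (by simpa using hq)]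
  unfold GG
  have e : ∀ k ∈ Finset.range q, 2 * (((q : ℝ) - k) / q ^ 2) * (1 + a * Real.cos (k * α) + b * Real.cos (k * β)) * Real.cos (k * (2 * π * x))
     = 2 / q ^ 2 * ((((q : ℝ) - k) * Real.cos (k * (2 * π * x)))
       + a / 2 * ((((q : ℝ) - k) * Real.cos (k * (2 * π * x + α))) + (((q : ℝ) - k) * Real.cos (k * (2 * π * x - α))))
       + b / 2 * ((((q : ℝ) - k) * Real.cos (k * (2 * π * x + β))) + (((q : ℝ) - k) * Real.cos (k * (2 * π * x - β))))) := by
    intro k _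
    rw [mul_add (k : ℝ), mul_sub (k : ℝ), mul_add (k : ℝ), mul_sub (k : ℝ), Real.cos_add, Real.cos_sub, Real.cos_add, Real.cos_sub]
    ring
  rw [Finset.sum_congr rfl e, ← Finset.mul_sum, Finset.sum_add_distrib, Finset.sum_add_distrib,
    ← Finset.mul_sum, ← Finset.mul_sum, Finset.sum_add_distrib, Finset.sum_add_distrib]
  generalize (∑ k ∈ Finset.range q, ((q : ℝ) - k) * Real.cos (k * (2 * π * x))) = S0
  generalize (∑ k ∈ Finset.range q, ((q : ℝ) - k) * Real.cos (k * (2 * π * x + α))) = S1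
  generalize (∑ k ∈ Finset.range q, ((q : ℝ) - k) * Real.cos (k * (2 * π * x - α))) = S2
  generalize (∑ k ∈ Finset.range q, ((q : ℝ) - k) * Real.cos (k * (2 * π * x + β))) = S3
  generalize (∑ k ∈ Finset.range q, ((q : ℝ) - k) * Real.cos (k * (2 * π * x - β))) = S4
  field_simp
  ring

/-- weak duality -/
lemma weak (q : ℕ) (hq : 7 ≤ q) (a : ℕ → ℝ) (ha : a ∈ TuranClass (3 / q)) (c : ℕ →₀ ℝ)
    (hc : c ∈ TrigClass (Kset 3 q)) : a 0 ≤ c 0 := by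
  obtain ⟨h0, hs, h1, hz⟩ := ha
  obtain ⟨hK, hpos, hc1⟩ := hc
  have hq0 : (0 : ℝ) < q := by positivity
  have hsum : ∀ y : ℝ, Summable fun n : ℕ => a n * Real.cos (2 * π * n * y) := by
    intro y
    refine Summable.of_norm_bounded hs fun n => ?_
    rw [norm_mul, Real.norm_of_nonneg (h0 n), Real.norm_eq_abs]
    exact mul_le_of_le_one_right (h0 n) (Real.abs_cos_le_one _)
  have hf : ∀ k : ℕ, k ∈ Kset 3 q → (∑' n : ℕ, a n * Real.cos (2 * π * n * (k / q))) = 0 := by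
    rintro k ⟨ν, k', rfl, hk3, hkq⟩
    have hk3' : (3 : ℝ) ≤ k' := by exact_mod_cast hk3
    have hkq' : (k' : ℝ) + 3 ≤ q := by exact_mod_cast (by omega : k' + 3 ≤ q)
    by_cases hle : 2 * k' ≤ q
    · have hle' : 2 * (k' : ℝ) ≤ q := by exact_mod_cast hle
      rw [← hz (k' / q)]
      · refine tsum_congr fun n => ?_
        congr 1
        rw [← Real.cos_add_nat_mul_two_pi (2 * π * n * (k' / q)) (n * ν)]
        congr 1; push_cast; field_simp; ring
      · rw [abs_of_nonneg (by positivity)]; gcongr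
      · rw [abs_of_nonneg (by positivity), div_le_iff₀ hq0]; linarith
    · have hle' : (q : ℝ) ≤ 2 * k' := by exact_mod_cast (by omega : q ≤ 2 * k')
      have e : |((k' : ℝ) - q) / q| = (q - k') / q := by
        rw [abs_div, abs_of_nonpos (by linarith), abs_of_pos hq0]; ring
      rw [← hz ((k' - q) / q)]
      · refine tsum_congr fun n => ?_
        congr 1
        rw [← Real.cos_add_nat_mul_two_pi (2 * π * n * ((k' - q) / q)) (n * (ν + 1))]
        congr 1; push_cast; field_simp; ring
      · rw [e]; gcongr; linarith
      · rw [e, div_le_iff₀ hq0]; linarith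
  have key : ∑ k ∈ c.support, c k * (∑' n : ℕ, a n * Real.cos (2 * π * n * (k / q))) = c 0 := by
    rw [Finset.sum_eq_single 0]
    · simp [h1]
    · intro k hk hk0
      rw [hf k (hK k hk0 (Finsupp.mem_support_iff.1 hk)), mul_zero]
    · intro h; rw [Finsupp.notMem_support_iff.1 h]; simp
  have key2 : ∑ k ∈ c.support, c k * (∑' n : ℕ, a n * Real.cos (2 * π * n * (k / q)))
      = ∑' n : ℕ, a n * trigEval c (n / q) := by
    simp_rw [← tsum_mul_left]
    rw [← Summable.tsum_finsetSum (fun k _ => (hsum _).mul_left _)]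
    refine tsum_congr fun n => ?_
    rw [trigEval, Finsupp.sum, Finset.mul_sum]
    refine Finset.sum_congr rfl fun k _ => ?_
    rw [show 2 * π * (n : ℝ) * (k / q) = 2 * π * k * (n / q) by ring]; ring
  have hS : Summable fun n : ℕ => a n * trigEval c (n / q) := by
    have : Summable fun n : ℕ => ∑ k ∈ c.support, c k * (a n * Real.cos (2 * π * n * (k / q))) :=
      summable_sum fun k _ => (hsum _).mul_left _
    refine this.congr fun n => ?_
    rw [trigEval, Finsupp.sum, Finset.mul_sum]
    refine Finset.sum_congr rfl fun k _ => ?_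
    rw [show 2 * π * (n : ℝ) * (k / q) = 2 * π * k * (n / q) by ring]; ring
  have := hS.le_tsum 0 (fun n _ => mul_nonneg (h0 n) (hpos _))
  rw [← key2, key] at this
  simpa [hc1] using this

/-- coefficients of the triangle function -/
noncomputable def triW (q : ℕ) (n : ℕ) : ℝ :=
  if n = 0 then 1 / q else q / π ^ 2 * (1 / (n : ℝ) ^ 2 * (1 - Real.cos (2 * π * n / q)))

lemma triW_nonneg (q n : ℕ) : 0 ≤ triW q n := by
  unfold triW
  split_ifs
  · positivity
  · have := Real.cos_le_one (2 * π * n / q)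
    have : 0 ≤ 1 - Real.cos (2 * π * n / q) := by linarith
    positivity

lemma hasSum_B (x : ℝ) (h0 : 0 ≤ x) (h1 : x ≤ 1) :
    HasSum (fun n : ℕ => 1 / (n : ℝ) ^ 2 * Real.cos (2 * π * n * x)) (π ^ 2 * (x ^ 2 - x + 1 / 6)) := by
  have := hasSum_one_div_nat_pow_mul_cos (k := 1) one_ne_zero (x := x) ⟨h0, h1⟩
  have e : (Polynomial.map (algebraMap ℚ ℝ) (Polynomial.bernoulli 2)).eval x = x ^ 2 - x + 1 / 6 := by
    simp [Polynomial.bernoulli, Finset.sum_range_succ, bernoulli_two, bernoulli_one, Polynomial.eval_monomial]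
    ring
  simp only [mul_one, e] at this
  rw [show π ^ 2 * (x ^ 2 - x + 1 / 6) = (-1) ^ (1 + 1) * (2 * π) ^ 2 / 2 / (Nat.factorial 2 : ℕ) * (x ^ 2 - x + 1 / 6) by
    norm_num [Nat.factorial]; left; ring]
  exact this

lemma tri_zero (q : ℕ) (hq : 2 ≤ q) (x : ℝ) (h0 : 1 / q ≤ x) (h1 : x ≤ 1 - 1 / q) :
    HasSum (fun n : ℕ => triW q n * Real.cos (2 * π * n * x)) 0 := by
  have hq0 : (0 : ℝ) < q := by positivity
  have hi : (0 : ℝ) < 1 / q := by positivity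
  have A := hasSum_B x (by linarith) (by linarith)
  have B := hasSum_B (x + 1 / q) (by linarith) (by linarith)
  have C := hasSum_B (x - 1 / q) (by linarith) (by linarith)
  have D := (((A.sub (B.mul_left (1 / 2))).sub (C.mul_left (1 / 2))).mul_left (q / π ^ 2)).add
    (hasSum_ite_eq 0 (1 / (q : ℝ)))
  refine (congrArg₂ (fun f s => HasSum f s) ?_ ?_).mpr D
  · funext n
    unfold triW
    by_cases h : n = 0
    · subst h; simp
    · simp only [h, if_false]
      rw [show 2 * π * n * (x + 1 / q) = 2 * π * n * x + 2 * π * n / q by ring,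
        show 2 * π * n * (x - 1 / q) = 2 * π * n * x - 2 * π * n / q by ring, Real.cos_add, Real.cos_sub]
      ring
  · field_simp; ring

lemma tri_one (q : ℕ) (hq : 2 ≤ q) :
    HasSum (fun n : ℕ => triW q n * Real.cos (2 * π * n * 0)) 1 := by
  have hq0 : (0 : ℝ) < q := by positivity
  have hi : (0 : ℝ) < 1 / q := by positivity
  have hi1 : (1 : ℝ) / q ≤ 1 := by
    rw [div_le_one hq0]; exact_mod_cast (by omega : 1 ≤ q)
  have A := hasSum_B 0 (by linarith) (by linarith)
  have B := hasSum_B (1 / q) (by linarith) (by linarith)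
  have D := ((A.sub B).mul_left (q / π ^ 2)).add (hasSum_ite_eq 0 (1 / (q : ℝ)))
  refine (congrArg₂ (fun f s => HasSum f s) ?_ ?_).mpr D
  · funext n
    unfold triW
    by_cases h : n = 0
    · subst h; simp
    · simp only [h, if_false]
      rw [show 2 * π * n * (1 / (q : ℝ)) = 2 * π * n / q by ring, mul_zero, Real.cos_zero]
      ring
  · field_simp; ring

lemma primal_sum (q : ℕ) (f1 f2 x s0 s1 s2 s3 s4 : ℝ)
    (H0 : HasSum (fun n : ℕ => triW q n * Real.cos (2 * π * n * x)) s0)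
    (H1 : HasSum (fun n : ℕ => triW q n * Real.cos (2 * π * n * (x + 1 / q))) s1)
    (H2 : HasSum (fun n : ℕ => triW q n * Real.cos (2 * π * n * (x - 1 / q))) s2)
    (H3 : HasSum (fun n : ℕ => triW q n * Real.cos (2 * π * n * (x + 2 / q))) s3)
    (H4 : HasSum (fun n : ℕ => triW q n * Real.cos (2 * π * n * (x - 2 / q))) s4) :
    HasSum (fun n : ℕ => triW q n * (1 + 2 * f1 * Real.cos (2 * π * n / q)
      + 2 * f2 * (2 * Real.cos (2 * π * n / q) ^ 2 - 1)) * Real.cos (2 * π * n * x))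
      (s0 + f1 * (s1 + s2) + f2 * (s3 + s4)) := by
  have D := (H0.add ((H1.add H2).mul_left f1)).add ((H3.add H4).mul_left f2)
  convert D using 1
  funext n
  rw [← Real.cos_two_mul, 
    show 2 * π * n * (x + 1 / q) = 2 * π * n * x + 2 * π * n / q by ring,
    show 2 * π * n * (x - 1 / q) = 2 * π * n * x - 2 * π * n / q by ring,
    show 2 * π * n * (x + 2 / q) = 2 * π * n * x + 2 * (2 * π * n / q) by ring,
    show 2 * π * n * (x - 2 / q) = 2 * π * n * x - 2 * (2 * π * n / q) by ring,
    Real.cos_add, Real.cos_sub, Real.cos_add, Real.cos_sub]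
  ring

lemma primal_mem (q : ℕ) (hq : 7 ≤ q) (f1 f2 : ℝ)
    (hg : ∀ n : ℕ, 0 ≤ 1 + 2 * f1 * Real.cos (2 * π * n / q)
      + 2 * f2 * (2 * Real.cos (2 * π * n / q) ^ 2 - 1)) :
    (fun n : ℕ => triW q n * (1 + 2 * f1 * Real.cos (2 * π * n / q)
      + 2 * f2 * (2 * Real.cos (2 * π * n / q) ^ 2 - 1))) ∈ TuranClass (3 / q) := by
  have hq0 : (0 : ℝ) < q := by positivity
  have hq7 : (7 : ℝ) ≤ q := by exact_mod_cast hq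
  set i : ℝ := 1 / q with hi
  have hi0 : 0 < i := by positivity
  have hi7 : 7 * i ≤ 1 := by
    rw [hi, mul_one_div, div_le_one hq0]; exact hq7
  have h2 : (2 : ℝ) / q = 2 * i := by rw [hi]; ring
  have h3 : (3 : ℝ) / q = 3 * i := by rw [hi]; ring
  have Z : ∀ x : ℝ, i ≤ |x| → |x| ≤ 1 - i →
      HasSum (fun n : ℕ => triW q n * Real.cos (2 * π * n * x)) 0 := by
    intro x ha hb
    have := tri_zero q (by omega) |x| ha hb
    rcases abs_choice x with h | h
    · rwa [h] at this
    · rw [h] at this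
      simpa using this
  have one : HasSum (fun n : ℕ => triW q n * (1 + 2 * f1 * Real.cos (2 * π * n / q)
      + 2 * f2 * (2 * Real.cos (2 * π * n / q) ^ 2 - 1))) 1 := by
    have := primal_sum q f1 f2 0 1 0 0 0 0 (tri_one q (by omega))
      (Z _ (by rw [← hi, zero_add, abs_of_pos hi0]) (by rw [← hi, zero_add, abs_of_pos hi0]; linarith))
      (Z _ (by rw [← hi, zero_sub, abs_neg, abs_of_pos hi0]) (by rw [← hi, zero_sub, abs_neg, abs_of_pos hi0]; linarith))
      (Z _ (by rw [h2, zero_add, abs_of_pos (by linarith)]; linarith) (by rw [h2, zero_add, abs_of_pos (by linarith)]; linarith))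
      (Z _ (by rw [h2, zero_sub, abs_neg, abs_of_pos (by linarith)]; linarith) (by rw [h2, zero_sub, abs_neg, abs_of_pos (by linarith)]; linarith))
    simpa using this
  refine ⟨fun n => mul_nonneg (triW_nonneg _ _) (hg n), one.summable, one.tsum_eq, ?_⟩
  intro x hx1 hx2
  rw [h3] at hx1
  have W : ∀ t : ℝ, |t| ≤ 2 * i → i ≤ |x + t| ∧ |x + t| ≤ 1 - i := by
    intro t ht
    have a1 := abs_add_le x t
    have a2 := abs_sub_abs_le_abs_sub x (-t)
    rw [sub_neg_eq_add, abs_neg] at a2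
    constructor <;> linarith
  have W1 := W i (by rw [abs_of_pos hi0]; linarith)
  have W2 := W (-i) (by rw [abs_neg, abs_of_pos hi0]; linarith)
  have W3 := W (2 * i) (by rw [abs_of_pos (by linarith)])
  have W4 := W (-(2 * i)) (by rw [abs_neg, abs_of_pos (by linarith)])
  rw [← sub_eq_add_neg] at W2 W4
  have := primal_sum q f1 f2 x 0 0 0 0 0 (Z x (by linarith) (by linarith)) (Z _ W1.1 W1.2) (Z _ W2.1 W2.2)
    (Z _ (by rw [h2]; exact W3.1) (by rw [h2]; exact W3.2))
    (Z _ (by rw [h2]; exact W4.1) (by rw [h2]; exact W4.2))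
  simpa using this.tsum_eq

lemma grid_sign (q m n : ℕ) (hq : 0 < q) (hm : 2 * (m + 1) ≤ q) :
    0 ≤ (Real.cos (2 * π * n / q) - Real.cos (2 * π * m / q)) *
      (Real.cos (2 * π * n / q) - Real.cos (2 * π * (m + 1 : ℕ) / q)) := by
  have hq0 : (0 : ℝ) < q := by positivity
  obtain ⟨r, hr, e⟩ : ∃ r : ℕ, 2 * r ≤ q ∧ Real.cos (2 * π * n / q) = Real.cos (2 * π * r / q) := by
    have e1 : Real.cos (2 * π * n / q) = Real.cos (2 * π * (n % q : ℕ) / q) := by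
      rw [← Real.cos_add_nat_mul_two_pi (2 * π * (n % q : ℕ) / q) (n / q)]
      congr 1
      have : (n : ℝ) = (n % q : ℕ) + q * (n / q : ℕ) := by exact_mod_cast (Nat.mod_add_div n q).symm
      rw [this]; field_simp
    by_cases h : 2 * (n % q) ≤ q
    · exact ⟨_, h, e1⟩
    · refine ⟨q - n % q, by omega, ?_⟩
      rw [e1, Nat.cast_sub (Nat.mod_lt _ hq).le, ← Real.cos_two_pi_sub]
      congr 1; field_simp
  have anti : ∀ i j : ℕ, i ≤ j → 2 * j ≤ q → Real.cos (2 * π * j / q) ≤ Real.cos (2 * π * i / q) := by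
    intro i j hij hj
    have hj' : 2 * (j : ℝ) ≤ q := by exact_mod_cast hj
    apply Real.cos_le_cos_of_nonneg_of_le_pi (by positivity)
    · rw [div_le_iff₀ hq0]; nlinarith [Real.pi_pos]
    · gcongr
  rw [e]
  rcases le_or_gt r m with h | h
  · have h1 := anti r m h (by omega)
    have h2 := anti r (m + 1) (by omega) (by omega)
    exact mul_nonneg (by linarith) (by linarith)
  · have h1 := anti m r (by omega) (by omega)
    have h2 := anti (m + 1) r (by omega) (by omega)
    exact mul_nonneg_of_nonpos_of_nonpos (by linarith) (by linarith)

lemma exists_opt (q : ℕ) (hq : 7 ≤ q) (hgcd : Nat.gcd 3 q = 1) :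
    ∃ a ∈ TuranClass (3 / q), ∃ c ∈ TrigClass (Kset0 3 q), a 0 = c 0 := by
  obtain ⟨m, hm2, hm⟩ : ∃ m, 2 ≤ m ∧ (q = 3 * m + 1 ∨ q = 3 * m + 2) := by
    have : q % 3 ≠ 0 := by
      intro h
      have := Nat.gcd_eq_left (Nat.dvd_of_mod_eq_zero h)
      omega
    exact ⟨q / 3, by omega, by omega⟩
  have hq0 : (0 : ℝ) < q := by positivity
  have hpi := Real.pi_pos
  set α : ℝ := 2 * π * m / q with hα
  set β : ℝ := 2 * π * (m + 1 : ℕ) / q with hβ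
  set u := Real.cos α with hu
  set v := Real.cos β with hv
  have hc : Real.cos (2 * π / 3) = -1 / 2 := by
    rw [show 2 * π / 3 = π - π / 3 by ring, Real.cos_pi_sub, Real.cos_pi_div_three]; norm_num
  have hm1 : 3 * (m : ℝ) < q := by exact_mod_cast (by omega : 3 * m < q)
  have hm3 : (q : ℝ) < 3 * (m + 1 : ℕ) := by exact_mod_cast (by omega : q < 3 * (m + 1))
  have hm4 : (q : ℝ) ≤ 4 * m := by exact_mod_cast (by omega : q ≤ 4 * m)
  have hm5 : 2 * ((m + 1 : ℕ) : ℝ) ≤ q := by exact_mod_cast (by omega : 2 * (m + 1) ≤ q)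
  have hbp : β ≤ π := by rw [hβ, div_le_iff₀ hq0]; nlinarith
  have hab : 2 * π / 3 < β := by rw [hβ, div_lt_div_iff₀ (by norm_num) hq0]; nlinarith
  have haa : α < 2 * π / 3 := by rw [hα, div_lt_div_iff₀ hq0 (by norm_num)]; nlinarith
  have ha2 : π / 2 ≤ α := by rw [hα, div_le_div_iff₀ (by norm_num) hq0]; nlinarith
  have hv1 : v < -1 / 2 := by
    rw [← hc]; exact Real.cos_lt_cos_of_nonneg_of_le_pi (by positivity) hbp hab
  have hu1 : -1 / 2 < u := by
    rw [← hc]; exact Real.cos_lt_cos_of_nonneg_of_le_pi (by linarith) (by linarith) haa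
  have hu0 : u ≤ 0 := Real.cos_nonpos_of_pi_div_two_le_of_le ha2 (by linarith)
  have hD : 0 < 1 + 2 * u * v := by nlinarith
  have huv : 0 < u - v := by linarith
  set a := (1 - v) * (-(1 + 2 * v)) / ((u - v) * (1 + 2 * u * v)) with hadef
  set b := (1 - u) * (1 + 2 * u) / ((u - v) * (1 + 2 * u * v)) with hbdef
  have ha0 : 0 ≤ a := div_nonneg (mul_nonneg (by linarith) (by linarith)) (by positivity)
  have hb0 : 0 ≤ b := div_nonneg (mul_nonneg (by linarith) (by linarith)) (by positivity)
  have E1 : 1 + a * u + b * v = 0 := by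
    have hD' := hD.ne'
    rw [hadef, hbdef]
    generalize hDD : 1 + 2 * u * v = D at hD'
    have huv' := huv.ne'
    field_simp; rw [← hDD]; ring
  have E2 : 1 + a * (2 * u ^ 2 - 1) + b * (2 * v ^ 2 - 1) = 0 := by
    have hD' := hD.ne'
    rw [hadef, hbdef]
    generalize hDD : 1 + 2 * u * v = D at hD'
    have huv' := huv.ne'
    field_simp; rw [← hDD]; ring
  refine ⟨_, primal_mem q hq (-(u + v) / (1 + 2 * u * v)) (1 / (2 * (1 + 2 * u * v))) ?_,
    dualC q a b α β, ⟨?_, ?_, ?_⟩, ?_⟩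
  · intro n
    have := grid_sign q m n (by omega) (by omega)
    rw [← hα, ← hβ, ← hu, ← hv] at this
    set c := Real.cos (2 * π * n / q)
    have e : 1 + 2 * (-(u + v) / (1 + 2 * u * v)) * c + 2 * (1 / (2 * (1 + 2 * u * v))) * (2 * c ^ 2 - 1)
      = 2 / (1 + 2 * u * v) * ((c - u) * (c - v)) := by field_simp; ring
    rw [e]; positivity
  · intro k hk0 hk
    simp only [dualC, Finsupp.onFinset_apply] at hk
    have hkq : k < q := by
      by_contra h; simp [h] at hk
    rw [if_pos hkq] at hk
    have hk' := right_ne_zero_of_mul hk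
    have c2 : ∀ t : ℝ, Real.cos ((2 : ℕ) * t) = 2 * Real.cos t ^ 2 - 1 := by
      intro t; push_cast; exact Real.cos_two_mul t
    have refl : ∀ j l : ℕ, j ≤ q → Real.cos (((q - j : ℕ) : ℝ) * (2 * π * l / q)) = Real.cos (j * (2 * π * l / q)) := by
      intro j l hj
      rw [Nat.cast_sub hj, ← Real.cos_nat_mul_two_pi_sub (j * (2 * π * l / q)) l]
      congr 1; field_simp
    have n1 : k ≠ 1 := by
      rintro rfl; apply hk'; simpa using E1
    have n2 : k ≠ 2 := by
      rintro rfl; apply hk'; rw [c2, c2]; exact E2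
    have n3 : k ≠ q - 1 := by
      rintro rfl; apply hk'; rw [hα, hβ, refl _ _ (by omega), refl _ _ (by omega), ← hα, ← hβ]; simpa using E1
    have n4 : k ≠ q - 2 := by
      rintro rfl; apply hk'; rw [hα, hβ, refl _ _ (by omega), refl _ _ (by omega), c2, c2, ← hα, ← hβ]; exact E2
    show 3 ≤ k ∧ k ≤ q - 3
    omega
  · intro x
    rw [dualC_eval q (by omega)]
    have := GG_nonneg q
    have := this (2 * π * x)
    have := GG_nonneg q (2 * π * x + α)
    have := GG_nonneg q (2 * π * x - α)
    have := GG_nonneg q (2 * π * x + β)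
    have := GG_nonneg q (2 * π * x - β)
    positivity
  · rw [dualC_eval q (by omega)]
    have ev : ∀ t, GG q (-t) = GG q t := by intro t; simp [GG]
    rw [mul_zero, zero_add, zero_sub, zero_add, zero_sub, ev, ev, GG_zero, hα, hβ,
      GG_root q m (by omega) (by omega), GG_root q (m + 1) (by omega) (by omega)]
    field_simp; simp
  · have hq' : 0 < q := by omega
    simp [dualC, triW, hq']
    rw [hadef, hbdef]
    field_simp
    ring

/-- Theorem 1, case `p = 3`:  `δ(K⁰_{3,q}) = δ(K_{3,q}) = A(3/q)`
for `q ≥ 7` with `gcd(3, q) = 1`. -/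
theorem stmt_4 (q : ℕ) (hq : 7 ≤ q) (hgcd : Nat.gcd 3 q = 1) :
    delta (Kset0 3 q) = turanA (3 / q) ∧ delta (Kset 3 q) = turanA (3 / q) := by
  obtain ⟨a, ha, c, hc, hac⟩ := exists_opt q hq hgcd
  have hsub : TrigClass (Kset0 3 q) ⊆ TrigClass (Kset 3 q) := by
    rintro d ⟨h1, h2, h3⟩
    refine ⟨fun k h0 h => ⟨0, k, by simp, h1 k h0 h⟩, h2, h3⟩
  have hA : turanA (3 / q) = c 0 := by
    refine IsGreatest.csSup_eq ⟨⟨a, ha, hac⟩, ?_⟩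
    rintro _ ⟨a', ha', rfl⟩
    exact weak q hq a' ha' c (hsub hc)
  have hl : ∀ d ∈ TrigClass (Kset 3 q), c 0 ≤ d 0 := by
    intro d hd
    rw [← hac]; exact weak q hq a ha d hd
  rw [hA]
  constructor
  · refine IsLeast.csInf_eq ⟨⟨c, hc, rfl⟩, ?_⟩
    rintro _ ⟨d, hd, rfl⟩
    exact hl d (hsub hd)
  · refine IsLeast.csInf_eq ⟨⟨c, hsub hc, rfl⟩, ?_⟩
    rintro _ ⟨d, hd, rfl⟩
    exact hl d hd
end

section
/- Let q ∈ ℕ with q ≥ 7 and gcd(3, q) = 1, and set r₀ = ⌊q/3⌋. Then δ(K⁰_{3,q}) = δ(K_{3,q}) = (1/q)·(1 + (1 − 2(cos(2πr₀/q) + cos(2π(r₀+1)/q)))/(1 + 2·cos(2πr₀/q)·cos(2π(r₀+1)/q))), where K⁰_{3,q} = {3, 4, …, q−3} and K_{3,q} = {qν + k : ν ∈ ℤ_{≥0}, k ∈ K⁰_{3,q}}. -/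
open Real

lemma tele_cos (φ : ℝ) (n : ℕ) :
    2 * sin (φ / 2) * ∑ j ∈ Finset.range n, cos (j * φ) = sin (n * φ - φ / 2) + sin (φ / 2) := by
  induction n with
  | zero => simp
  | succ n ih =>
    rw [Finset.sum_range_succ, mul_add, ih]
    have h : ((n + 1 : ℕ) : ℝ) * φ - φ / 2 = n * φ + φ / 2 := by push_cast; ring
    rw [h, sin_add, sin_sub]; ring

lemma tele_sin (φ : ℝ) (n : ℕ) :
    2 * sin (φ / 2) * ∑ j ∈ Finset.range n, sin (j * φ) = cos (φ / 2) - cos (n * φ - φ / 2) := by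
  induction n with
  | zero => simp
  | succ n ih =>
    rw [Finset.sum_range_succ, mul_add, ih]
    have h : ((n + 1 : ℕ) : ℝ) * φ - φ / 2 = n * φ + φ / 2 := by push_cast; ring
    rw [h, cos_add, cos_sub]; ring

lemma sin_half_ne (q : ℕ) (hq : 0 < q) (m : ℤ) (hm : ¬ (q : ℤ) ∣ m) :
    sin (2 * π * m / q / 2) ≠ 0 := by
  intro h
  rw [sin_eq_zero_iff] at h
  obtain ⟨n, hn⟩ := h
  apply hm
  refine ⟨n, ?_⟩
  have hq' : (q : ℝ) ≠ 0 := by positivity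
  have hpi := pi_ne_zero
  have : (m : ℝ) = q * n := by
    field_simp at hn
    rw [← hn]; ring
  exact_mod_cast this

lemma sum_cos_zero (q : ℕ) (hq : 0 < q) (m : ℤ) (hm : ¬ (q : ℤ) ∣ m) :
    ∑ j ∈ Finset.range q, cos (j * (2 * π * m / q)) = 0 := by
  have h := tele_cos (2 * π * m / q) q
  have hq' : (q : ℝ) ≠ 0 := by positivity
  have e : (q : ℝ) * (2 * π * m / q) - 2 * π * m / q / 2 = m * (2 * π) - 2 * π * m / q / 2 := by
    field_simp
  rw [e, sin_int_mul_two_pi_sub, neg_add_cancel] at h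
  have := sin_half_ne q hq m hm
  simpa [this] using h

lemma sum_sin_zero (q : ℕ) (hq : 0 < q) (m : ℤ) (hm : ¬ (q : ℤ) ∣ m) :
    ∑ j ∈ Finset.range q, sin (j * (2 * π * m / q)) = 0 := by
  have h := tele_sin (2 * π * m / q) q
  have hq' : (q : ℝ) ≠ 0 := by positivity
  have e : (q : ℝ) * (2 * π * m / q) - 2 * π * m / q / 2 = m * (2 * π) - 2 * π * m / q / 2 := by
    field_simp
  rw [e, cos_int_mul_two_pi_sub, sub_self] at h
  have := sin_half_ne q hq m hm
  simpa [this] using h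

lemma fejer_aux (t : ℝ) (n : ℕ) :
    2 * ∑ k ∈ Finset.range n, ((n : ℝ) - k) * cos (k * t) - n =
      (∑ j ∈ Finset.range n, cos (j * t)) ^ 2 + (∑ j ∈ Finset.range n, sin (j * t)) ^ 2 := by
  induction n with
  | zero => simp
  | succ n ih =>
    rw [Finset.sum_range_succ (fun j : ℕ => cos (j * t)),
      Finset.sum_range_succ (fun j : ℕ => sin (j * t))]
    have h1 : ∑ k ∈ Finset.range (n + 1), (((n + 1 : ℕ) : ℝ) - k) * cos (k * t) =
        ∑ k ∈ Finset.range n, ((n : ℝ) - k) * cos (k * t) +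
          ∑ k ∈ Finset.range (n + 1), cos (k * t) := by
      rw [Finset.sum_range_succ, Finset.sum_range_succ (fun k : ℕ => cos (k * t)), ← add_assoc,
        ← Finset.sum_add_distrib]
      congr 1
      · apply Finset.sum_congr rfl; intros; push_cast; ring
      · push_cast; ring
    have h2 : ∑ k ∈ Finset.range (n + 1), cos (k * t) =
        1 + (∑ j ∈ Finset.range n, cos (j * t)) * cos (n * t) +
          (∑ j ∈ Finset.range n, sin (j * t)) * sin (n * t) := by
      rw [← Finset.sum_range_reflect, Finset.sum_range_succ, Finset.sum_mul, Finset.sum_mul,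
        add_assoc, ← Finset.sum_add_distrib, add_comm]
      congr 1
      · simp
      · apply Finset.sum_congr rfl
        intro j hj
        have hj' := Finset.mem_range.1 hj
        have : ((n + 1 - 1 - j : ℕ) : ℝ) = n - j := by
          rw [Nat.add_sub_cancel, Nat.cast_sub hj'.le]
        rw [this, sub_mul, cos_sub]; ring
    rw [h1, h2]
    have := sin_sq_add_cos_sq ((n : ℝ) * t)
    push_cast
    nlinarith [ih, this]

/-- Fejer coefficients. -/
noncomputable def fejC (q k : ℕ) : ℝ := if k = 0 then 1 / q else (2 / q) * (1 - k / q)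

noncomputable def fej (q : ℕ) (t : ℝ) : ℝ := ∑ k ∈ Finset.range q, fejC q k * cos (k * t)

lemma fej_eq (q : ℕ) (hq : 0 < q) (t : ℝ) :
    fej q t = ((∑ j ∈ Finset.range q, cos (j * t)) ^ 2 +
      (∑ j ∈ Finset.range q, sin (j * t)) ^ 2) / q ^ 2 := by
  have hq' : (q : ℝ) ≠ 0 := by positivity
  rw [← fejer_aux, eq_div_iff (by positivity), fej]
  obtain ⟨n, rfl⟩ : ∃ n, q = n + 1 := ⟨q - 1, by omega⟩
  rw [Finset.sum_range_succ', Finset.sum_range_succ' (fun k : ℕ => (((n + 1 : ℕ) : ℝ) - k) * _)]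
  rw [add_mul, mul_add, Finset.sum_mul, Finset.mul_sum, add_sub_assoc]
  congr 1
  · apply Finset.sum_congr rfl
    intro k _
    simp only [fejC, Nat.succ_ne_zero, if_false]
    field_simp
  · simp only [fejC, if_true]
    push_cast at hq' ⊢
    field_simp
    simp
    ring

lemma fej_nonneg (q : ℕ) (hq : 0 < q) (t : ℝ) : 0 ≤ fej q t := by
  rw [fej_eq q hq]; positivity

lemma fej_zero (q : ℕ) (hq : 0 < q) : fej q 0 = 1 := by
  rw [fej_eq q hq]
  have hq' : (q : ℝ) ≠ 0 := by positivity
  simp [hq']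

lemma fej_node (q : ℕ) (hq : 0 < q) (m : ℤ) (hm : ¬ (q : ℤ) ∣ m) :
    fej q (2 * π * m / q) = 0 := by
  rw [fej_eq q hq, sum_cos_zero q hq m hm, sum_sin_zero q hq m hm]; simp

lemma fej_neg (q : ℕ) (t : ℝ) : fej q (-t) = fej q t := by simp [fej]

/-- Nonnegativity of the weights. -/
lemma weight_nonneg (q r j : ℕ) (hr : 2 * (r + 1) ≤ q) (hj : j < q) :
    0 ≤ (cos (2 * π * j / q) - cos (2 * π * r / q)) *
      (cos (2 * π * j / q) - cos (2 * π * (r + 1) / q)) := by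
  have hq : 0 < q := by omega
  have hq' : (0 : ℝ) < q := by exact_mod_cast hq
  have key : ∀ a b : ℕ, a ≤ b → 2 * b ≤ q → cos (2 * π * b / q) ≤ cos (2 * π * a / q) := by
    intro a b hab hb
    apply cos_le_cos_of_nonneg_of_le_pi
    · positivity
    · rw [div_le_iff₀ hq']
      have : (2 : ℝ) * b ≤ q := by exact_mod_cast hb
      nlinarith [pi_pos]
    · gcongr
  have key2 : ∀ i : ℕ, 2 * i ≤ q → 0 ≤ (cos (2 * π * i / q) - cos (2 * π * r / q)) *
      (cos (2 * π * i / q) - cos (2 * π * (r + 1) / q)) := by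
    intro i hi
    have h0 := key r (r + 1) (by omega) hr
    push_cast at h0
    rcases Nat.lt_or_ge r i with h | h
    · have h1 := key (r + 1) i h hi
      push_cast at h1
      exact mul_nonneg_of_nonpos_of_nonpos (by linarith) (by linarith)
    · have h1 := key i r h (by omega)
      exact mul_nonneg (by linarith) (by linarith)
  rcases Nat.lt_or_ge q (2 * j) with h | h
  · have h1 := key2 (q - j) (by omega)
    have e : cos (2 * π * (q - j : ℕ) / q) = cos (2 * π * j / q) := by
      rw [Nat.cast_sub hj.le]
      have : 2 * π * ((q : ℝ) - j) / q = 2 * π - 2 * π * j / q := by field_simp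
      rw [this, cos_two_pi_sub]
    rwa [e] at h1
  · exact key2 j h

lemma weight_sum (q : ℕ) (hq : 0 < q) (a b : ℝ) (k : ℤ)
    (hk : ∀ e : ℤ, -2 ≤ e → e ≤ 2 → ¬ (q : ℤ) ∣ k + e) :
    ∑ j ∈ Finset.range q, (cos (2 * π * j / q) - a) * (cos (2 * π * j / q) - b) *
      cos (2 * π * k * (j / q)) = 0 := by
  have H := fun e h1 h2 => sum_cos_zero q hq (k + e) (hk e h1 h2)
  have e0 := H 0 (by norm_num) (by norm_num)
  have e1 := H 1 (by norm_num) (by norm_num)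
  have e2 := H 2 (by norm_num) (by norm_num)
  have e3 := H (-1) (by norm_num) (by norm_num)
  have e4 := H (-2) (by norm_num) (by norm_num)
  have : ∀ j ∈ Finset.range q, (cos (2 * π * j / q) - a) * (cos (2 * π * j / q) - b) *
      cos (2 * π * k * (j / q)) =
      (1 / 4) * cos (j * (2 * π * ((k + 2 : ℤ) : ℝ) / q))
      + (1 / 4) * cos (j * (2 * π * ((k + -2 : ℤ) : ℝ) / q))
      + (-(a + b) / 2) * cos (j * (2 * π * ((k + 1 : ℤ) : ℝ) / q))
      + (-(a + b) / 2) * cos (j * (2 * π * ((k + -1 : ℤ) : ℝ) / q))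
      + (1 / 2 + a * b) * cos (j * (2 * π * ((k + 0 : ℤ) : ℝ) / q)) := by
    intro j _
    set θ := 2 * π * (j : ℝ) / q with hθ
    set φ := 2 * π * (k : ℝ) * (j / q) with hφ
    have f2 : (j * (2 * π * ((k + 2 : ℤ) : ℝ) / q)) = φ + 2 * θ := by
      rw [hθ, hφ]; push_cast; ring
    have f2' : (j * (2 * π * ((k + -2 : ℤ) : ℝ) / q)) = φ - 2 * θ := by
      rw [hθ, hφ]; push_cast; ring
    have f1 : (j * (2 * π * ((k + 1 : ℤ) : ℝ) / q)) = φ + θ := by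
      rw [hθ, hφ]; push_cast; ring
    have f1' : (j * (2 * π * ((k + -1 : ℤ) : ℝ) / q)) = φ - θ := by
      rw [hθ, hφ]; push_cast; ring
    have f0 : (j * (2 * π * ((k + 0 : ℤ) : ℝ) / q)) = φ := by
      rw [hφ]; push_cast; ring
    rw [f2, f2', f1, f1', f0, cos_add, cos_sub, cos_add, cos_sub, cos_two_mul]
    ring
  rw [Finset.sum_congr rfl this]
  simp only [Finset.sum_add_distrib, ← Finset.mul_sum]
  rw [e0, e1, e2, e3, e4]; simp

lemma weight_sum_zero (q : ℕ) (hq : 3 ≤ q) (a b : ℝ) :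
    ∑ j ∈ Finset.range q, (cos (2 * π * j / q) - a) * (cos (2 * π * j / q) - b) =
      q * (1 / 2 + a * b) := by
  have e1 := sum_cos_zero q (by omega) 1 (fun h => by have := Int.le_of_dvd (by norm_num) h; omega)
  have e2 := sum_cos_zero q (by omega) 2 (fun h => by have := Int.le_of_dvd (by norm_num) h; omega)
  have : ∀ j ∈ Finset.range q, (cos (2 * π * j / q) - a) * (cos (2 * π * j / q) - b) =
      (1 / 2) * cos (j * (2 * π * ((2 : ℤ) : ℝ) / q))
      + (-(a + b)) * cos (j * (2 * π * ((1 : ℤ) : ℝ) / q))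
      + (1 / 2 + a * b) := by
    intro j _
    set θ := 2 * π * (j : ℝ) / q with hθ
    have f2 : (j * (2 * π * ((2 : ℤ) : ℝ) / q)) = 2 * θ := by
      rw [hθ]; push_cast; ring
    have f1 : (j * (2 * π * ((1 : ℤ) : ℝ) / q)) = θ := by
      rw [hθ]; push_cast; ring
    rw [f2, f1, cos_two_mul]
    ring
  rw [Finset.sum_congr rfl this]
  simp only [Finset.sum_add_distrib, ← Finset.mul_sum]
  rw [e1, e2]; simp; ring

lemma lower_bound (q r : ℕ) (hq : 7 ≤ q) (hr : 2 * (r + 1) ≤ q) (c : ℕ →₀ ℝ)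
    (hc : c ∈ TrigClass (Kset 3 q)) :
    (1 - cos (2 * π * r / q)) * (1 - cos (2 * π * (r + 1) / q)) ≤
      c 0 * (q * (1 / 2 + cos (2 * π * r / q) * cos (2 * π * (r + 1) / q))) := by
  obtain ⟨hK, hpos, h1⟩ := hc
  set a := cos (2 * π * r / q) with ha
  set b := cos (2 * π * (r + 1) / q) with hb
  have hS : ∑ j ∈ Finset.range q, (cos (2 * π * j / q) - a) * (cos (2 * π * j / q) - b) *
      trigEval c (j / q) = c 0 * (q * (1 / 2 + a * b)) := by
    simp only [trigEval, Finsupp.sum, Finset.mul_sum]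
    rw [Finset.sum_comm]
    rw [Finset.sum_eq_single 0]
    · rw [← weight_sum_zero q (by omega), Finset.mul_sum]
      apply Finset.sum_congr rfl
      intro j _
      simp; ring
    · intro k _ hk0
      by_cases hck : c k = 0
      · simp [hck]
      obtain ⟨ν, k', rfl, h3, h4⟩ := hK k hk0 hck
      have := weight_sum q (by omega) a b ((q * ν + k' : ℕ) : ℤ) (by
        intro e he1 he2 hd
        have h5 : (q : ℤ) ∣ k' + e := by
          have : ((q * ν + k' : ℕ) : ℤ) + e = q * ν + (k' + e) := by push_cast; ring
          rw [this] at hd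
          exact (Int.dvd_add_right (Dvd.intro _ rfl)).1 hd
        have := Int.le_of_dvd (by omega) h5
        omega)
      rw [Int.cast_natCast] at this
      rw [← mul_zero (c (q * ν + k')), ← this, Finset.mul_sum]
      apply Finset.sum_congr rfl
      intro j _
      ring
    · intro h
      have : c 0 = 0 := by simpa using h
      simp [this]
  rw [← hS]
  have := Finset.single_le_sum (f := fun j : ℕ => (cos (2 * π * j / q) - a) *
    (cos (2 * π * j / q) - b) * trigEval c (j / q)) (s := Finset.range q)
    (fun j hj => mul_nonneg (weight_nonneg q r j hr (Finset.mem_range.1 hj)) (hpos _))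
    (Finset.mem_range.2 (show 0 < q by omega))
  simpa [h1] using this

lemma exists_poly (q r : ℕ) (hq : 7 ≤ q) (hr0 : 0 < r) (hr : 2 * (r + 1) ≤ q) (A B : ℝ)
    (hA : 0 ≤ A) (hB : 0 ≤ B)
    (h1 : 1 + 2 * A * cos (2 * π * r / q) + 2 * B * cos (2 * π * (r + 1) / q) = 0)
    (h2 : 1 + 2 * A * (2 * cos (2 * π * r / q) ^ 2 - 1)
      + 2 * B * (2 * cos (2 * π * (r + 1) / q) ^ 2 - 1) = 0) :
    ∃ c ∈ TrigClass (Kset0 3 q), c 0 = (1 / q) * (1 + 2 * A + 2 * B) := by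
  have hq0 : 0 < q := by omega
  have hq' : (q : ℝ) ≠ 0 := by positivity
  set t := 2 * π * (r : ℝ) / q with ht
  set s := 2 * π * ((r : ℝ) + 1) / q with hs
  let f : ℕ → ℝ := fun k => if k < q then
    fejC q k * (1 + 2 * A * cos (k * t) + 2 * B * cos (k * s)) else 0
  let c : ℕ →₀ ℝ := Finsupp.onFinset (Finset.range q) f (by
    intro k hk
    by_contra h
    apply hk
    simp only [f]
    rw [if_neg (by simpa using h)])
  have hcf : ∀ k, c k = f k := fun k => rfl
  have hev : ∀ x, trigEval c x = fej q (2 * π * x) +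
      A * (fej q (2 * π * x - t) + fej q (2 * π * x + t)) +
      B * (fej q (2 * π * x - s) + fej q (2 * π * x + s)) := by
    intro x
    rw [trigEval, Finsupp.onFinset_sum _ (by simp)]
    simp only [fej, ← Finset.sum_add_distrib, Finset.mul_sum]
    apply Finset.sum_congr rfl
    intro k hk
    simp only [f, if_pos (Finset.mem_range.1 hk)]
    simp only [mul_sub (k : ℝ), mul_add (k : ℝ), cos_sub, cos_add]
    rw [show 2 * π * (k : ℝ) * x = k * (2 * π * x) by ring]
    ring
  have hrefl : ∀ m n : ℕ, n ≤ q → cos ((q - n : ℕ) * (2 * π * (m : ℝ) / q)) =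
      cos (n * (2 * π * (m : ℝ) / q)) := by
    intro m n hn
    rw [Nat.cast_sub hn]
    have : ((q : ℝ) - n) * (2 * π * (m : ℝ) / q) = m * (2 * π) - n * (2 * π * (m : ℝ) / q) := by
      field_simp
    rw [this, cos_nat_mul_two_pi_sub]
  have hs' : s = 2 * π * ((r + 1 : ℕ) : ℝ) / q := by rw [hs]; push_cast; ring
  have z1 : f 1 = 0 := by
    simp only [f]; simp [h1]
  have z2 : f 2 = 0 := by
    simp only [f]; simp [cos_two_mul, h2]
  have z3 : f (q - 1) = 0 := by
    simp only [f]; rw [ht, hs', hrefl _ _ (by omega), hrefl _ _ (by omega), ← hs', ← ht]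
    simp [h1]
  have z4 : f (q - 2) = 0 := by
    simp only [f]; rw [ht, hs', hrefl _ _ (by omega), hrefl _ _ (by omega), ← hs', ← ht]
    simp [cos_two_mul, h2]
  refine ⟨c, ⟨?_, ?_, ?_⟩, ?_⟩
  · intro k hk0 hk
    rw [hcf] at hk
    have hkq : k < q := by
      by_contra h
      exact hk (by simp only [f]; rw [if_neg h])
    have n1 : k ≠ 1 := by rintro rfl; exact hk z1
    have n2 : k ≠ 2 := by rintro rfl; exact hk z2
    have n3 : k ≠ q - 1 := by rintro rfl; exact hk z3
    have n4 : k ≠ q - 2 := by rintro rfl; exact hk z4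
    show 3 ≤ k ∧ k ≤ q - 3
    omega
  · intro x
    rw [hev]
    have := fej_nonneg q hq0
    have a1 := mul_nonneg hA (add_nonneg (this (2 * π * x - t)) (this (2 * π * x + t)))
    have a2 := mul_nonneg hB (add_nonneg (this (2 * π * x - s)) (this (2 * π * x + s)))
    linarith [this (2 * π * x)]
  · rw [hev]
    have nt := fej_node q hq0 r (fun h => by have := Int.le_of_dvd (by omega) h; omega)
    have ns := fej_node q hq0 (r + 1) (fun h => by have := Int.le_of_dvd (by omega) h; omega)
    push_cast at nt ns
    rw [← ht] at nt
    rw [← hs] at ns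
    simp [fej_zero q hq0, fej_neg, nt, ns]
  · rw [hcf]
    simp [f, hq0, fejC]

theorem stmt_5 (q : ℕ) (hq : 7 ≤ q) (hgcd : Nat.gcd 3 q = 1) (r₀ : ℕ) (hr : r₀ = q / 3) :
    delta (Kset0 3 q) =
      (1 / q) * (1 + (1 - 2 * (Real.cos (2 * π * r₀ / q) + Real.cos (2 * π * (r₀ + 1) / q))) /
        (1 + 2 * Real.cos (2 * π * r₀ / q) * Real.cos (2 * π * (r₀ + 1) / q))) ∧
    delta (Kset 3 q) =
      (1 / q) * (1 + (1 - 2 * (Real.cos (2 * π * r₀ / q) + Real.cos (2 * π * (r₀ + 1) / q))) /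
        (1 + 2 * Real.cos (2 * π * r₀ / q) * Real.cos (2 * π * (r₀ + 1) / q))) := by
  have h3 : ¬ 3 ∣ q := by
    intro h
    rw [Nat.gcd_eq_left h] at hgcd
    omega
  have hb1 : 3 * r₀ < q := by omega
  have hb2 : q < 3 * (r₀ + 1) := by omega
  have hb3 : q ≤ 4 * r₀ := by omega
  have hb4 : 2 * (r₀ + 1) ≤ q := by omega
  have hqp : (0 : ℝ) < q := by positivity
  have hb1' : 3 * (r₀ : ℝ) < q := by exact_mod_cast hb1
  have hb2' : (q : ℝ) < 3 * (r₀ + 1) := by exact_mod_cast hb2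
  have hb3' : (q : ℝ) ≤ 4 * r₀ := by exact_mod_cast hb3
  have hb4' : 2 * ((r₀ : ℝ) + 1) ≤ q := by exact_mod_cast hb4
  have hlow := lower_bound q r₀ hq hb4
  have hex := exists_poly q r₀ hq (by omega) hb4
  have hpi := pi_pos
  have hc23 : cos (2 * π / 3) = -1 / 2 := by
    rw [show 2 * π / 3 = π - π / 3 by ring, cos_pi_sub, cos_pi_div_three]; norm_num
  have ha1 : -1 / 2 < cos (2 * π * r₀ / q) := by
    rw [← hc23]
    apply cos_lt_cos_of_nonneg_of_le_pi
    · positivity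
    · linarith
    · rw [div_lt_div_iff₀ hqp (by norm_num)]; nlinarith
  have hbb : cos (2 * π * (r₀ + 1) / q) < -1 / 2 := by
    rw [← hc23]
    apply cos_lt_cos_of_nonneg_of_le_pi
    · positivity
    · rw [div_le_iff₀ hqp]; nlinarith
    · rw [div_lt_div_iff₀ (by norm_num) hqp]; nlinarith
  have ha2 : cos (2 * π * r₀ / q) ≤ 0 := by
    apply cos_nonpos_of_pi_div_two_le_of_le
    · rw [div_le_div_iff₀ (by norm_num) hqp]; nlinarith
    · have : 2 * π * (r₀ : ℝ) / q ≤ π := by rw [div_le_iff₀ hqp]; nlinarith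
      linarith
  set a := cos (2 * π * r₀ / q) with ha
  set b := cos (2 * π * (r₀ + 1) / q) with hb
  have hM : 0 < 1 + 2 * a * b := by nlinarith
  have hab : 0 < a - b := by linarith
  have hM' := hM.ne'
  have hab' := hab.ne'
  have hq' := hqp.ne'
  have hD : (a - b) * (1 + 2 * a * b) ≠ 0 := mul_ne_zero hab' hM'
  have haux : ∀ x y N P D : ℝ, D ≠ 0 → D + N * x + P * y = 0 →
      1 + 2 * (N / (2 * D)) * x + 2 * (P / (2 * D)) * y = 0 := by
    intro x y N P D hD h
    field_simp
    linarith
  obtain ⟨c, hc, hc0⟩ := hex ((1 - b) * (-1 - 2 * b) / (2 * ((a - b) * (1 + 2 * a * b))))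
    ((1 - a) * (1 + 2 * a) / (2 * ((a - b) * (1 + 2 * a * b))))
    (div_nonneg (mul_nonneg (by linarith) (by linarith)) (by positivity))
    (div_nonneg (mul_nonneg (by linarith) (by linarith)) (by positivity))
    (haux _ _ _ _ _ hD (by ring)) (haux _ _ _ _ _ hD (by ring))
  have hv : c 0 = (1 / q) * (1 + (1 - 2 * (a + b)) / (1 + 2 * a * b)) := by
    rw [hc0]; field_simp; ring
  have hsub : TrigClass (Kset0 3 q) ⊆ TrigClass (Kset 3 q) := by
    rintro d ⟨h1, h2⟩
    refine ⟨fun k hk hd => ⟨0, k, by simp, h1 k hk hd⟩, h2⟩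
  have hlb : ∀ d ∈ TrigClass (Kset 3 q),
      (1 / q) * (1 + (1 - 2 * (a + b)) / (1 + 2 * a * b)) ≤ d 0 := by
    intro d hd
    have := hlow d hd
    have e : (1 / q) * (1 + (1 - 2 * (a + b)) / (1 + 2 * a * b)) =
        (1 - a) * (1 - b) / (q * (1 / 2 + a * b)) := by
      have : (1 / 2 + a * b) ≠ 0 := by
        intro h; apply hM'; linarith
      field_simp; ring
    rw [e, div_le_iff₀ (mul_pos hqp (by linarith))]
    exact this
  constructor
  · apply IsLeast.csInf_eq
    refine ⟨⟨c, hc, hv⟩, ?_⟩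
    rintro _ ⟨d, hd, rfl⟩
    exact hlb d (hsub hd)
  · apply IsLeast.csInf_eq
    refine ⟨⟨c, hsub hc, hv⟩, ?_⟩
    rintro _ ⟨d, hd, rfl⟩
    exact hlb d hd
end

section
/- Let p, q ∈ ℕ with 2p ≤ q and gcd(p, q) = 1. Then A(p/q) ≤ δ(K_{p,q}), where K_{p,q} = {qν + k : ν ∈ ℤ_{≥0}, k ∈ {p, p+1, …, q−p}}. -/
open Real

lemma cos_shift_aux (n : ℕ) (x : ℝ) (m : ℤ) :
    Real.cos (2 * π * n * (x + m)) = Real.cos (2 * π * n * x) := by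
  have : 2 * π * n * (x + m) = 2 * π * n * x + ((n * m : ℤ) : ℝ) * (2 * π) := by
    push_cast; ring
  rw [this, Real.cos_add_int_mul_two_pi]

lemma turan_zero_aux (p q : ℕ) (hp : 0 < p) (hpq : 2 * p ≤ q) (a : ℕ → ℝ)
    (ha : a ∈ TuranClass (p / q)) (k : ℕ) (hk : k ∈ Kset p q) :
    (∑' n : ℕ, a n * Real.cos (2 * π * n * (k / q))) = 0 := by
  obtain ⟨ν, k', rfl, h1, h2⟩ := hk
  have hq : (0 : ℝ) < q := by exact_mod_cast (by omega : 0 < q)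
  have h1' : (p : ℝ) ≤ k' := by exact_mod_cast h1
  have h2' : (k' : ℝ) + p ≤ q := by exact_mod_cast (by omega : k' + p ≤ q)
  have h0 := ha.2.2.2
  by_cases hc : (2 : ℝ) * k' ≤ q
  · have e : (((q * ν + k' : ℕ) : ℝ) / q) = (k' : ℝ) / q + (ν : ℤ) := by
      push_cast; field_simp; ring
    simp_rw [e, cos_shift_aux]
    apply h0
    · rw [abs_of_nonneg (by positivity)]; gcongr
    · rw [abs_of_nonneg (by positivity), div_le_div_iff₀ hq (by norm_num)]; linarith
  · have e : (((q * ν + k' : ℕ) : ℝ) / q) = -(((q : ℝ) - k') / q) + ((ν + 1 : ℤ) : ℝ) := by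
      push_cast; field_simp; ring
    simp_rw [e, cos_shift_aux]
    have hp0 : (0 : ℝ) ≤ p := by positivity
    have hn : (0 : ℝ) ≤ ((q : ℝ) - k') / q := div_nonneg (by linarith) hq.le
    apply h0
    · rw [abs_neg, abs_of_nonneg hn]; gcongr; linarith
    · rw [abs_neg, abs_of_nonneg hn, div_le_div_iff₀ hq (by norm_num)]; linarith

lemma key_aux (p q : ℕ) (hp : 0 < p) (hpq : 2 * p ≤ q) (a : ℕ → ℝ)
    (ha : a ∈ TuranClass (p / q)) (c : ℕ →₀ ℝ) (hc : c ∈ TrigClass (Kset p q)) :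
    a 0 ≤ c 0 := by
  obtain ⟨ha0, has, ha1, -⟩ := id ha
  obtain ⟨hK, hpos, h1⟩ := hc
  have hs : ∀ x : ℝ, Summable fun n : ℕ => a n * Real.cos (2 * π * n * x) := by
    intro x
    refine Summable.of_norm_bounded has fun n => ?_
    rw [norm_mul, Real.norm_eq_abs, Real.norm_eq_abs, abs_of_nonneg (ha0 n)]
    exact mul_le_of_le_one_right (ha0 n) (Real.abs_cos_le_one _)
  have hsum : HasSum (fun n : ℕ => ∑ k ∈ c.support, c k * (a n * Real.cos (2 * π * n * (k / q))))
      (∑ k ∈ c.support, c k * ∑' n : ℕ, a n * Real.cos (2 * π * n * (k / q))) :=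
    hasSum_sum fun k _ => ((hs _).hasSum).mul_left _
  have hL : ∀ n : ℕ, ∑ k ∈ c.support, c k * (a n * Real.cos (2 * π * n * (k / q)))
      = a n * trigEval c (n / q) := by
    intro n
    rw [trigEval, Finsupp.sum, Finset.mul_sum]
    refine Finset.sum_congr rfl fun k _ => ?_
    rw [show 2 * π * n * ((k : ℝ) / q) = 2 * π * k * ((n : ℝ) / q) by ring]; ring
  have hR : ∑ k ∈ c.support, c k * ∑' n : ℕ, a n * Real.cos (2 * π * n * (k / q)) = c 0 := by
    rw [Finset.sum_eq_single 0]
    · simp [ha1]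
    · intro k hk hk0
      rw [turan_zero_aux p q hp hpq a ha k (hK k hk0 (Finsupp.mem_support_iff.1 hk)), mul_zero]
    · intro h; rw [Finsupp.notMem_support_iff.1 h, zero_mul]
  simp_rw [hL] at hsum
  rw [hR] at hsum
  have := le_hasSum hsum 0 fun n _ => mul_nonneg (ha0 n) (hpos _)
  simpa [h1] using this

lemma integral_aux (k : ℕ) (hk : k ≠ 0) :
    ∫ x in (0 : ℝ)..1, Real.cos (2 * π * k * x) = 0 := by
  have hne : 2 * π * (k : ℝ) ≠ 0 := by positivity
  rw [intervalIntegral.integral_comp_mul_left (fun x => Real.cos x) hne, integral_cos]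
  have : Real.sin (2 * π * k * 1) = 0 := by
    rw [show 2 * π * (k : ℝ) * 1 = ((2 * k : ℕ) : ℝ) * π by push_cast; ring]
    exact Real.sin_nat_mul_pi _
  rw [this]; simp

lemma nonneg_aux (K : Set ℕ) (c : ℕ →₀ ℝ) (hc : c ∈ TrigClass K) : 0 ≤ c 0 := by
  have h : 0 ≤ ∫ x in (0 : ℝ)..1, trigEval c x :=
    intervalIntegral.integral_nonneg (by norm_num) fun x _ => hc.2.1 x
  unfold trigEval Finsupp.sum at h
  rw [intervalIntegral.integral_finsetSum
    (fun k _ => (Continuous.intervalIntegrable (by fun_prop) _ _)), Finset.sum_eq_single 0] at h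
  · simpa using h
  · intro k _ hk
    rw [intervalIntegral.integral_const_mul, integral_aux k hk, mul_zero]
  · intro h; simp [Finsupp.notMem_support_iff.1 h]

/-- The lower estimate:  `A(p/q) ≤ δ(K_{p,q})` for `2p ≤ q`, `gcd(p, q) = 1`. -/
theorem stmt_8 (p q : ℕ) (hp : 0 < p) (hpq : 2 * p ≤ q) (hgcd : Nat.gcd p q = 1) :
    turanA (p / q) ≤ delta (Kset p q) := by
  have hne : ((fun c : ℕ →₀ ℝ => c 0) '' TrigClass (Kset p q)).Nonempty := by
    refine ⟨_, Finsupp.single 0 1, ⟨?_, ?_, ?_⟩, rfl⟩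
    · intro k hk h
      exact absurd (Finsupp.single_eq_of_ne hk) h
    · intro x; simp [trigEval]
    · simp [trigEval]
  refine le_csInf hne ?_
  rintro _ ⟨c, hc, rfl⟩
  refine Real.sSup_le ?_ (nonneg_aux _ c hc)
  rintro _ ⟨a, ha, rfl⟩
  exact key_aux p q hp hpq a ha c hc
end
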